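/- arXiv:1604.08538 — 3 statements merged into one kernel-verified Lean document; each statement's English description precedes it below -/
import Mathlib

section
/- Let C ≤ G^n be an additive code of minimum distance d ≥ 2 whose dual C⊥ has minimum distance d⊥ ≥ 2, with genera g = n+1−d−log_{|G|}|C| and g⊥ = n+1−d⊥−log_{|G|}|C⊥|. Then there exist unique polynomials P_C(t), P_{C⊥}(t) ∈ ℚ[t] of degree at most g + g⊥ with P_C(1) = P_{C⊥}(1) = 1 such that the homogeneous weight enumerators satisfy W_C(x,y) = ∑_i a_i M_{n,d+i}(x,y) and W_{C⊥}(x,y) = ∑_i a_i⊥ M_{n,d⊥+i}(x,y), where a_i, a_i⊥ are the coefficients of P_C, P_{C⊥} and M_{n,s} are the MDS weight enumerators. -/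
open MvPolynomial

/-- The dual code of a set `C ⊆ Gⁿ` of words. -/
def dualCodeSet {G : Type*} [AddCommGroup G] (n : ℕ) (C : Set (Fin n → G)) :
    Set (Fin n → AddChar G ℂ) :=
  {π | ∀ c ∈ C, ∏ j, π j (c j) = 1}

/-- The Hamming weight of a tuple of characters: the number of nontrivial coordinates. -/
noncomputable def charWeight {G : Type*} [AddCommGroup G] {n : ℕ}
    (π : Fin n → AddChar G ℂ) : ℕ :=
  Nat.card {j : Fin n // π j ≠ 1}

/-- Homogeneous weight enumerator of a set of words in `Gⁿ`. -/
noncomputable def weightEnum {G : Type*} [AddCommGroup G] [Fintype G] [DecidableEq G]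
    (n : ℕ) (C : Set (Fin n → G)) : MvPolynomial (Fin 2) ℚ :=
  ∑ᶠ c ∈ C, X 0 ^ (n - hammingNorm c) * X 1 ^ hammingNorm c

/-- Homogeneous weight enumerator of a set of character tuples in `Ĝⁿ`. -/
noncomputable def dualEnum {G : Type*} [AddCommGroup G] (n : ℕ)
    (S : Set (Fin n → AddChar G ℂ)) : MvPolynomial (Fin 2) ℚ :=
  ∑ᶠ π ∈ S, X 0 ^ (n - charWeight π) * X 1 ^ charWeight π

/-- The MDS weight enumerator `M_{n,d}(x,y)` over a group of order `q`. -/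
noncomputable def mdsEnum (q n d : ℕ) : MvPolynomial (Fin 2) ℚ :=
  X 0 ^ n + ∑ s ∈ Finset.Icc d n,
    MvPolynomial.C ((n.choose s : ℚ) * ((q : ℚ) - 1) *
        ∑ i ∈ Finset.range (s - d + 1),
          (-1 : ℚ) ^ i * ((s - 1).choose i : ℚ) * (q : ℚ) ^ (s - d - i)) *
      X 0 ^ (n - s) * X 1 ^ s


namespace ZetaAux

/-- homogeneous polynomial with given coefficients -/
noncomputable def hom (n : ℕ) (a : ℕ → ℚ) : MvPolynomial (Fin 2) ℚ :=
  ∑ s ∈ Finset.range (n + 1), MvPolynomial.C (a s) * X 0 ^ (n - s) * X 1 ^ s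

/-- coefficient functional -/
noncomputable def cf (n s : ℕ) (F : MvPolynomial (Fin 2) ℚ) : ℚ :=
  MvPolynomial.coeff (Finsupp.single 0 (n - s) + Finsupp.single 1 s) F

lemma cf_mono (n s w : ℕ) (a : ℚ) (hs : s ≤ n) :
    cf n s (MvPolynomial.C a * X 0 ^ (n - w) * X 1 ^ w) = if w = s then a else 0 := by
  have h : (MvPolynomial.C a * X 0 ^ (n - w) * X 1 ^ w : MvPolynomial (Fin 2) ℚ)
      = MvPolynomial.monomial (Finsupp.single 0 (n - w) + Finsupp.single 1 w) a := by
    rw [X_pow_eq_monomial, X_pow_eq_monomial, C_mul_monomial, monomial_mul]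
    simp
  rw [cf, h, coeff_monomial]
  by_cases hw : w = s
  · simp [hw]
  · rw [if_neg, if_neg hw]
    intro h2
    have := DFunLike.congr_fun h2 1
    simp at this
    exact hw this

lemma cf_sum {ι : Type*} (n s : ℕ) (S : Finset ι) (F : ι → MvPolynomial (Fin 2) ℚ) :
    cf n s (∑ i ∈ S, F i) = ∑ i ∈ S, cf n s (F i) := by
  simp [cf, coeff_sum]

lemma cf_smul (n s : ℕ) (a : ℚ) (F : MvPolynomial (Fin 2) ℚ) :
    cf n s (a • F) = a * cf n s F := by
  simp [cf]

lemma cf_hom (n s : ℕ) (a : ℕ → ℚ) (hs : s ≤ n) : cf n s (hom n a) = a s := by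
  rw [hom, cf_sum, Finset.sum_congr rfl (fun w _ => cf_mono n s w (a w) hs)]
  rw [Finset.sum_ite_eq' (Finset.range (n+1)) s a]
  simp; omega

lemma hom_congr (n : ℕ) (a b : ℕ → ℚ) (h : ∀ s ≤ n, a s = b s) : hom n a = hom n b := by
  refine Finset.sum_congr rfl fun s hs => ?_
  rw [h s (by simp at hs; omega)]

lemma hom_sum {ι : Type*} (n : ℕ) (S : Finset ι) (c : ι → ℚ) (a : ι → ℕ → ℚ) :
    hom n (fun s => ∑ i ∈ S, c i * a i s) = ∑ i ∈ S, c i • hom n (a i) := by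
  simp only [hom, Finset.smul_sum, map_sum, Finset.sum_mul]
  rw [Finset.sum_comm]
  refine Finset.sum_congr rfl fun i _ => Finset.sum_congr rfl fun s _ => ?_
  rw [MvPolynomial.smul_eq_C_mul, map_mul]; ring

/-- coefficients of MDS -/
noncomputable def mu (q n d s : ℕ) : ℚ :=
  if s = 0 then 1 else if s < d then 0 else
    (n.choose s : ℚ) * ((q : ℚ) - 1) *
        ∑ i ∈ Finset.range (s - d + 1),
          (-1 : ℚ) ^ i * ((s - 1).choose i : ℚ) * (q : ℚ) ^ (s - d - i)

lemma mds_eq (q n d : ℕ) (hd : 1 ≤ d) : mdsEnum q n d = hom n (mu q n d) := by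
  rw [hom, Finset.sum_range_succ', add_comm, mdsEnum]
  congr 1
  · simp [mu]
  · rw [← Finset.sum_image (s := Finset.range n) (g := fun s => s + 1)
      (f := fun s => MvPolynomial.C (mu q n d s) * X 0 ^ (n - s) * X 1 ^ s) (by intro a _ b _; simp)]
    have : Finset.Icc d n ⊆ Finset.image (fun s => s + 1) (Finset.range n) := by
      intro s hs
      simp only [Finset.mem_Icc, Finset.mem_image, Finset.mem_range] at *
      exact ⟨s - 1, by omega, by omega⟩
    rw [← Finset.sum_subset this]
    · refine Finset.sum_congr rfl fun s hs => ?_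
      simp only [Finset.mem_Icc] at hs
      rw [mu, if_neg (by omega), if_neg (by omega)]
    · intro s hs hs'
      simp only [Finset.mem_Icc, Finset.mem_image, Finset.mem_range] at *
      obtain ⟨a, ha, rfl⟩ := hs
      rw [mu, if_neg (by omega), if_pos (by omega)]
      simp

lemma mu_zero (q n d : ℕ) : mu q n d 0 = 1 := by simp [mu]

lemma mu_lt (q n d s : ℕ) (h0 : 0 < s) (h : s < d) : mu q n d s = 0 := by
  rw [mu, if_neg (by omega), if_pos h]

lemma mu_self (q n d : ℕ) (hq : 2 ≤ q) (h0 : 0 < d) (h : d ≤ n) : mu q n d d ≠ 0 := by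
  rw [mu, if_neg (by omega), if_neg (by omega)]
  simp only [Nat.sub_self, zero_add, Finset.sum_range_one]
  have h1 : (n.choose d : ℚ) ≠ 0 := by exact_mod_cast (Nat.choose_pos h).ne'
  have h2 : ((q : ℚ) - 1) ≠ 0 := by
    have : (2 : ℚ) ≤ q := by exact_mod_cast hq
    intro h; linarith
  simp [h1, h2]

lemma scalar (s m : ℕ) (q : ℚ) (hm : m ≤ s + 1) :
    ∑ l ∈ Finset.range (s + 2), (-1 : ℚ) ^ l * ((s + 1).choose l : ℚ) * q ^ (m - l)
    = (q - 1) * ∑ i ∈ Finset.range m, (-1 : ℚ) ^ i * (s.choose i : ℚ) * q ^ (m - 1 - i) := by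
  have h1 : ∑ l ∈ Finset.range (s + 2), (-1 : ℚ) ^ l * ((s + 1).choose l : ℚ) * q ^ (m - l)
      = ∑ l ∈ Finset.range (s + 1), (-1 : ℚ) ^ l * (s.choose l : ℚ) *
        (q ^ (m - l) - q ^ (m - (l + 1))) := by
    have e : ∑ l ∈ Finset.range (s + 1), (-1 : ℚ) ^ l * (s.choose l : ℚ) * q ^ (m - l)
        = ∑ l ∈ Finset.range (s + 1), (-1 : ℚ) ^ (l + 1) * (s.choose (l + 1) : ℚ) * q ^ (m - (l + 1))
          + q ^ m := by
      have := Finset.sum_range_succ' (fun l => (-1 : ℚ) ^ l * (s.choose l : ℚ) * q ^ (m - l)) (s + 1)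
      rw [Finset.sum_range_succ] at this
      simpa using this
    rw [Finset.sum_range_succ']
    simp only [mul_sub, Finset.sum_sub_distrib]
    rw [e, add_sub_right_comm, ← Finset.sum_sub_distrib]
    congr 1
    · refine Finset.sum_congr rfl fun l _ => ?_
      rw [Nat.choose_succ_succ]; push_cast; ring
    · simp
  rw [h1, Finset.mul_sum]
  have hsub : Finset.range m ⊆ Finset.range (s + 1) := by
    intro a; simp only [Finset.mem_range]; omega
  rw [← Finset.sum_subset hsub]
  · refine Finset.sum_congr rfl fun l hl => ?_
    simp only [Finset.mem_range] at hl
    obtain ⟨c, rfl⟩ : ∃ c, m = l + 1 + c := ⟨m - (l + 1), by omega⟩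
    rw [show l + 1 + c - l = c + 1 by omega, show l + 1 + c - (l + 1) = c by omega,
      show l + 1 + c - 1 - l = c by omega]
    ring
  · intro l _ hl
    simp only [Finset.mem_range] at hl
    rw [show m - l = 0 by omega, show m - (l + 1) = 0 by omega]
    simp

/-- binomial-moment form of the MDS enumerator -/
noncomputable def dd (q n k : ℕ) : MvPolynomial (Fin 2) ℚ :=
  ∑ r ∈ Finset.range (n + 1),
    MvPolynomial.C ((n.choose r : ℚ) * (q : ℚ) ^ (k - (n - r))) * (X 0 - X 1) ^ (n - r) * X 1 ^ r

lemma dd_eq (q n d : ℕ) (h1 : 1 ≤ d) (h2 : d ≤ n + 1) : dd q n (n + 1 - d) = hom n (mu q n d) := by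
  have key : ∀ r ∈ Finset.range (n + 1),
      (MvPolynomial.C ((n.choose r : ℚ) * (q : ℚ) ^ (n + 1 - d - (n - r))) * (X 0 - X 1) ^ (n - r)
        * X 1 ^ r : MvPolynomial (Fin 2) ℚ)
      = ∑ m ∈ Finset.range (n + 1 - r),
        MvPolynomial.C ((n.choose r : ℚ) * (q : ℚ) ^ (n + 1 - d - (n - r)) * (-1) ^ m *
          ((n - r).choose m : ℚ)) * X 0 ^ (n - (r + m)) * X 1 ^ (r + m) := by
    intro r hr
    simp only [Finset.mem_range] at hr
    rw [sub_eq_add_neg, add_comm (X 0 : MvPolynomial (Fin 2) ℚ), add_pow, Finset.mul_sum, Finset.sum_mul,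
      show n + 1 - r = n - r + 1 by omega]
    refine Finset.sum_congr rfl fun m _ => ?_
    rw [neg_pow, show n - (r + m) = n - r - m by omega, pow_add]
    simp only [map_mul, map_pow, map_neg, map_one, map_natCast]
    ring
  rw [dd, Finset.sum_congr rfl key, hom]
  rw [← Finset.sum_range_diag_flip (n + 1) (fun r m =>
        (MvPolynomial.C ((n.choose r : ℚ) * (q : ℚ) ^ (n + 1 - d - (n - r)) * (-1) ^ m *
          ((n - r).choose m : ℚ)) * X 0 ^ (n - (r + m)) * X 1 ^ (r + m) :
            MvPolynomial (Fin 2) ℚ))]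
  refine Finset.sum_congr rfl fun s hs => ?_
  simp only [Finset.mem_range] at hs
  have : mu q n d s = ∑ r ∈ Finset.range (s + 1), (n.choose r : ℚ) *
      (q : ℚ) ^ (n + 1 - d - (n - r)) * (-1) ^ (s - r) * ((n - r).choose (s - r) : ℚ) := by
    have e : ∑ r ∈ Finset.range (s + 1), (n.choose r : ℚ) *
      (q : ℚ) ^ (n + 1 - d - (n - r)) * (-1) ^ (s - r) * ((n - r).choose (s - r) : ℚ)
      = (n.choose s : ℚ) * ∑ l ∈ Finset.range (s + 1), (-1 : ℚ) ^ l * (s.choose l : ℚ)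
          * (q : ℚ) ^ (s + 1 - d - l) := by
      rw [← Finset.sum_range_reflect (fun l => (-1 : ℚ) ^ l * (s.choose l : ℚ)
          * (q : ℚ) ^ (s + 1 - d - l)), Finset.mul_sum]
      refine Finset.sum_congr rfl fun r hr => ?_
      simp only [Finset.mem_range] at hr
      have hc : (n.choose s : ℚ) * (s.choose r : ℚ)
          = (n.choose r : ℚ) * ((n - r).choose (s - r) : ℚ) := by
        exact_mod_cast Nat.choose_mul (n := n) (show r ≤ s by omega)
      rw [show s + 1 - 1 - r = s - r by omega, Nat.choose_symm (show r ≤ s by omega),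
        show n + 1 - d - (n - r) = s + 1 - d - (s - r) by omega]
      linear_combination (-(q : ℚ) ^ (s + 1 - d - (s - r)) * (-1) ^ (s - r)) * hc
    rw [e]
    rcases s with _ | s
    · rw [mu_zero]; simp
      rw [show 1 - d = 0 by omega]; simp
    · rw [scalar s _ _ (by omega), mu, if_neg (by omega)]
      split_ifs with h
      · rw [show s + 1 + 1 - d = 0 by omega]; simp
      · rw [show s + 1 - d + 1 = s + 1 + 1 - d by omega, show s + 1 - 1 = s by omega,
          show s + 1 + 1 - d - 1 = s + 1 - d by omega]
        ring
  rw [this, map_sum, Finset.sum_mul, Finset.sum_mul]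
  refine Finset.sum_congr rfl fun r hr => ?_
  simp only [Finset.mem_range] at hr
  rw [show r + (s - r) = s by omega]

lemma dd_transform (q n k : ℕ) (hk : k ≤ n) :
    MvPolynomial.bind₁ (fun j : Fin 2 => if j = 0 then
              X 0 + MvPolynomial.C ((q : ℚ) - 1) * X 1
            else X 0 - X 1) (dd q n k) = ((q : ℚ) ^ k) • dd q n (n - k) := by
  rw [dd, map_sum, dd, Finset.smul_sum, ← Finset.sum_range_reflect]
  refine Finset.sum_congr rfl fun r hr => ?_
  simp only [Finset.mem_range] at hr
  simp only [map_mul, map_pow, map_sub, bind₁_X_right, bind₁_C_right, if_true,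
    show (1 : Fin 2) ≠ 0 by decide, if_false]
  rw [show n + 1 - 1 - r = n - r by omega, Nat.choose_symm (show r ≤ n by omega),
    show n - (n - r) = r by omega, MvPolynomial.smul_eq_C_mul]
  have : (X 0 + (MvPolynomial.C (q : ℚ) - MvPolynomial.C 1) * X 1 - (X 0 - X 1) :
      MvPolynomial (Fin 2) ℚ) = MvPolynomial.C (q : ℚ) * X 1 := by
    rw [map_one]; ring
  rw [this, mul_pow]
  have e : (MvPolynomial.C (q : ℚ) : MvPolynomial (Fin 2) ℚ) ^ (k - r) * MvPolynomial.C (q : ℚ) ^ r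
    = MvPolynomial.C (q : ℚ) ^ k * MvPolynomial.C (q : ℚ) ^ (n - k - (n - r)) := by
    rw [← pow_add, ← pow_add]; congr 1; omega
  simp only [map_pow]
  linear_combination (MvPolynomial.C (n.choose r : ℚ) * X 1 ^ r * (X 0 - X 1) ^ (n - r)) * e

lemma mds_transform (q n d : ℕ) (h1 : 1 ≤ d) (h2 : d ≤ n + 1) :
    MvPolynomial.bind₁ (fun j : Fin 2 => if j = 0 then
              X 0 + MvPolynomial.C ((q : ℚ) - 1) * X 1
            else X 0 - X 1) (mdsEnum q n d)
      = ((q : ℚ) ^ (n + 1 - d)) • mdsEnum q n (n + 2 - d) := by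
  rw [mds_eq _ _ _ h1, mds_eq _ _ _ (by omega), ← dd_eq q n d h1 h2,
    ← dd_eq q n (n + 2 - d) (by omega) (by omega), dd_transform _ _ _ (by omega),
    show n + 1 - (n + 2 - d) = n - (n + 1 - d) by omega]

lemma exists_expand (q n : ℕ) (hq : 2 ≤ q) (e : ℕ) : ∀ (d : ℕ), 1 ≤ d → d + e = n + 1 →
    ∀ A : ℕ → ℚ, (∀ s, 0 < s → s < d → A s = 0) →
    ∃ a : ℕ → ℚ, ∀ s ≤ n, A s = ∑ t ∈ Finset.Icc d (n + 1), a t * mu q n t s := by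
  induction e with
  | zero =>
    intro d h1 h2 A hA
    refine ⟨fun _ => A 0, fun s hs => ?_⟩
    obtain rfl : d = n + 1 := by omega
    rw [Finset.Icc_self, Finset.sum_singleton]
    rcases Nat.eq_zero_or_pos s with rfl | h
    · rw [mu_zero, mul_one]
    · rw [mu_lt _ _ _ _ h (by omega), hA s h (by omega), mul_zero]
  | succ e ih =>
    intro d h1 h2 A hA
    have hne := mu_self q n d hq h1 (by omega)
    obtain ⟨a, ha⟩ := ih (d + 1) (by omega) (by omega)
      (fun s => A s - A d / mu q n d d * mu q n d s) (by
        intro s h0 hs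
        rcases Nat.lt_or_ge s d with h | h
        · simp [hA s h0 h, mu_lt _ _ _ _ h0 h]
        · obtain rfl : s = d := by omega
          field_simp; ring)
    refine ⟨Function.update a d (A d / mu q n d d), fun s hs => ?_⟩
    rw [← Finset.insert_Icc_add_one_left_eq_Icc (by omega), Finset.sum_insert (by simp)]
    rw [Finset.sum_congr rfl (g := fun t => a t * mu q n t s), ← ha s hs]
    · simp
    · intro t ht
      simp only [Finset.mem_Icc] at ht
      rw [Function.update_of_ne (by omega)]

lemma expand_zero (q n : ℕ) (hq : 2 ≤ q) (d N e : ℕ) (hd : 1 ≤ d) (hN : N ≤ n) (a : ℕ → ℚ)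
    (h : ∀ s, 0 < s → s ≤ n → s < e → ∑ t ∈ Finset.Icc d N, a t * mu q n t s = 0) :
    ∀ t, d ≤ t → t ≤ N → t < e → a t = 0 := by
  intro t
  induction t using Nat.strong_induction_on with
  | _ t ih =>
    intro h1 h2 h3
    have := h t (by omega) (by omega) h3
    rw [Finset.sum_eq_single t] at this
    · exact (mul_eq_zero.mp this).resolve_right (mu_self q n t hq (by omega) (by omega))
    · intro u hu hne
      simp only [Finset.mem_Icc] at hu
      rcases Nat.lt_or_ge u t with h | h
      · rw [ih u h hu.1 hu.2 (by omega), zero_mul]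
      · rw [mu_lt _ _ _ _ (by omega) (by omega), mul_zero]
    · intro h; simp at h; omega

lemma cf_mds (q n d s : ℕ) (hd : 1 ≤ d) (hs : s ≤ n) : cf n s (mdsEnum q n d) = mu q n d s := by
  rw [mds_eq _ _ _ hd, cf_hom _ _ _ hs]

lemma sum_range_Icc {M : Type*} [AddCommMonoid M] (d m : ℕ) (f : ℕ → M) :
    ∑ i ∈ Finset.range (m + 1), f (d + i) = ∑ t ∈ Finset.Icc d (d + m), f t := by
  rw [← Finset.Ico_succ_right_eq_Icc, Finset.sum_Ico_eq_sum_range]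
  congr 2
  simp; omega

lemma final (q n d m : ℕ) (hq : 2 ≤ q) (hd : 1 ≤ d) (hm : d + m ≤ n)
    (W : MvPolynomial (Fin 2) ℚ) (hW : cf n 0 W = 1) (a : ℕ → ℚ)
    (ha : W = ∑ t ∈ Finset.Icc d (d + m), a t • mdsEnum q n t) :
    ∃! P : Polynomial ℚ, P.natDegree ≤ m ∧ P.eval 1 = 1 ∧
        W = ∑ i ∈ Finset.range (m + 1), P.coeff i • mdsEnum q n (d + i) := by
  have hco : ∀ i ∈ Finset.range (m + 1),
      (∑ j ∈ Finset.range (m + 1), Polynomial.monomial j (a (d + j))).coeff i = a (d + i) := by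
    intro i hi
    rw [Polynomial.finsetSum_coeff]
    simp only [Polynomial.coeff_monomial]
    rw [Finset.sum_ite_eq' (Finset.range (m+1)) i (fun j => a (d + j)), if_pos hi]
  refine ⟨∑ i ∈ Finset.range (m + 1), Polynomial.monomial i (a (d + i)), ⟨?_, ?_, ?_⟩, ?_⟩
  · refine Polynomial.natDegree_sum_le_of_forall_le _ _ fun i hi => ?_
    simp only [Finset.mem_range] at hi
    exact (Polynomial.natDegree_monomial_le _).trans (by omega)
  · rw [Polynomial.eval_finsetSum]
    simp only [Polynomial.eval_monomial, one_pow, mul_one]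
    rw [sum_range_Icc d m a, ← hW, ha, cf_sum]
    refine Finset.sum_congr rfl fun t ht => ?_
    simp only [Finset.mem_Icc] at ht
    rw [cf_smul, cf_mds _ _ _ _ (by omega) (by omega), mu_zero, mul_one]
  · rw [Finset.sum_congr rfl (fun i hi => by rw [hco i hi]),
      sum_range_Icc d m (fun t => a t • mdsEnum q n t), ha]
  · rintro Q ⟨hQ, -, hQW⟩
    have hz := expand_zero q n hq d (d + m) (n + 1) hd hm (fun t => Q.coeff (t - d) - a t) (by
      intro s h0 hs _
      have e : ∑ i ∈ Finset.range (m + 1), Q.coeff i • mdsEnum q n (d + i)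
        = ∑ t ∈ Finset.Icc d (d + m), Q.coeff (t - d) • mdsEnum q n t := by
        rw [← sum_range_Icc d m (fun t => Q.coeff (t - d) • mdsEnum q n t)]
        simp
      rw [e, ha] at hQW
      have := congrArg (cf n s) hQW
      simp only [cf_sum, cf_smul] at this
      simp only [sub_mul, Finset.sum_sub_distrib]
      rw [sub_eq_zero]
      refine Eq.trans ?_ (this.symm.trans ?_) <;>
      · refine Finset.sum_congr rfl fun t ht => ?_
        simp only [Finset.mem_Icc] at ht
        rw [cf_mds _ _ _ _ (by omega) hs])
    ext i
    by_cases hi : i < m + 1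
    · rw [hco i (by simpa using hi)]
      have := hz (d + i) (by omega) (by omega) (by omega)
      simp only [Nat.add_sub_cancel_left] at this
      linarith
    · rw [Polynomial.coeff_eq_zero_of_natDegree_lt (by omega), Polynomial.finsetSum_coeff,
        Finset.sum_eq_zero]
      intro j hj
      simp only [Finset.mem_range] at hj
      rw [Polynomial.coeff_monomial, if_neg (by omega)]

lemma enum_lemma {α : Type*} [Finite α] (n d : ℕ) (hd : 0 < d) (S : Set α) (wt : α → ℕ) (z : α)
    (hz : z ∈ S) (hwz : wt z = 0) (hwt : ∀ c, wt c ≤ n) (hdist : ∀ c ∈ S, c ≠ z → d ≤ wt c) :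
    ∃ A : ℕ → ℚ, (∑ᶠ c ∈ S, (X 0 ^ (n - wt c) * X 1 ^ wt c : MvPolynomial (Fin 2) ℚ)) = hom n A ∧
      A 0 = 1 ∧ (∀ s, 0 < s → s < d → A s = 0) ∧
      MvPolynomial.eval (fun _ => (1 : ℚ))
        (∑ᶠ c ∈ S, (X 0 ^ (n - wt c) * X 1 ^ wt c : MvPolynomial (Fin 2) ℚ)) = Nat.card S := by
  classical
  have hS : S.Finite := S.toFinite
  rw [finsum_mem_eq_finite_toFinset_sum _ hS]
  refine ⟨fun s => ∑ c ∈ hS.toFinset, 1 * (if wt c = s then 1 else 0), ?_, ?_, ?_, ?_⟩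
  · rw [hom_sum n hS.toFinset (fun _ => 1) (fun c s => if wt c = s then (1 : ℚ) else 0)]
    refine Finset.sum_congr rfl fun c _ => ?_
    rw [one_smul, hom, Finset.sum_eq_single (wt c)]
    · simp
    · intro b _ hb; rw [if_neg (Ne.symm hb)]; simp
    · intro h; simp at h; have := hwt c; omega
  · simp only [one_mul]
    rw [Finset.sum_eq_single z]
    · simp [hwz]
    · intro b hb hne
      rw [if_neg]
      have := hdist b (by simpa using hb) hne
      omega
    · intro h; simp at h; exact absurd hz h
  · intro s h0 hs
    refine Finset.sum_eq_zero fun c hc => ?_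
    rw [if_neg, mul_zero]
    by_cases h : c = z
    · subst h; omega
    · have := hdist c (by simpa using hc) h; omega
  · simp only [map_sum, map_mul, map_pow, eval_X, one_pow, mul_one, Finset.sum_const, nsmul_eq_mul]
    rw [Nat.card_coe_set_eq, Set.ncard_eq_toFinset_card S hS]

lemma singleton_bound {α : Type*} [Finite α] (n d : ℕ) (hd : 1 ≤ d)
    (S : Set (Fin n → α))
    (h : ∀ x ∈ S, ∀ y ∈ S, x ≠ y → d ≤ Nat.card {j : Fin n // x j ≠ y j}) :
    Nat.card S ≤ Nat.card α ^ (n + 1 - d) := by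
  classical
  have hle : n + 1 - d ≤ n := by omega
  rw [← Nat.card_fin (n + 1 - d), ← Nat.card_fun]
  refine Nat.card_le_card_of_injective
    (fun (x : S) (i : Fin (n + 1 - d)) => (x : Fin n → α) (Fin.castLE hle i)) ?_
  rintro ⟨x, hx⟩ ⟨y, hy⟩ hxy
  by_contra hne
  have h1 := h x hx y hy (fun e => hne (by simp [e]))
  rw [Nat.card_eq_fintype_card, Fintype.card_subtype] at h1
  have hdis : Disjoint (Finset.univ.filter fun j : Fin n => x j ≠ y j)
      (Finset.univ.map (Fin.castLEEmb hle)) := by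
    rw [Finset.disjoint_left]
    intro j hj hj'
    simp only [Finset.mem_map, Finset.mem_univ, true_and, Finset.mem_filter] at hj hj'
    obtain ⟨i, rfl⟩ := hj'
    exact hj (congrFun hxy i)
  have h2 := Finset.card_le_univ
    ((Finset.univ.filter fun j : Fin n => x j ≠ y j).disjUnion _ hdis)
  rw [Finset.card_disjUnion, Finset.card_map, Finset.card_univ, Fintype.card_fin,
    Fintype.card_fin] at h2
  omega

end ZetaAux

/-- For an additive code `C ≤ Gⁿ` of minimum distance `d ≥ 2`, with
dual of minimum distance `d⊥ ≥ 2`, genera `g = n+1-d-k` and `g⊥ = k+1-d⊥` (where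
`|C| = |G|^k`), and satisfying the MacWilliams identity, there exist unique
ζ-polynomials `P_C, P_{C⊥} ∈ ℚ[t]` of degree at most `g + g⊥` with value `1` at `t = 1`
whose coefficients express the weight enumerators of `C` and `C⊥` in terms of the MDS
weight enumerators. -/
theorem exists_unique_zeta_polynomial {G : Type*} [AddCommGroup G] [Fintype G]
    [DecidableEq G] [Nontrivial G]
    (n k d d' g g' : ℕ) (hd : 2 ≤ d) (hd' : 2 ≤ d')
    (C : AddSubgroup (Fin n → G))
    (hk : Nat.card C = Fintype.card G ^ k)
    (hmin : IsLeast {w | ∃ c ∈ C, c ≠ 0 ∧ hammingNorm c = w} d)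
    (hmin' : IsLeast {w | ∃ π ∈ dualCodeSet n (C : Set (Fin n → G)),
      π ≠ (fun _ => 1) ∧ charWeight π = w} d')
    (hg : g = n + 1 - d - k) (hg' : g' = k + 1 - d')
    (hMW : MvPolynomial.C ((Nat.card C : ℚ)) *
        dualEnum n (dualCodeSet n (C : Set (Fin n → G)))
      = MvPolynomial.bind₁
          (fun j : Fin 2 => if j = 0 then
              X 0 + MvPolynomial.C ((Fintype.card G : ℚ) - 1) * X 1
            else X 0 - X 1)
          (weightEnum n (C : Set (Fin n → G)))) :
    (∃! P : Polynomial ℚ, P.natDegree ≤ g + g' ∧ P.eval 1 = 1 ∧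
        weightEnum n (C : Set (Fin n → G))
          = ∑ i ∈ Finset.range (g + g' + 1),
              P.coeff i • mdsEnum (Fintype.card G) n (d + i)) ∧
    (∃! P' : Polynomial ℚ, P'.natDegree ≤ g + g' ∧ P'.eval 1 = 1 ∧
        dualEnum n (dualCodeSet n (C : Set (Fin n → G)))
          = ∑ i ∈ Finset.range (g + g' + 1),
              P'.coeff i • mdsEnum (Fintype.card G) n (d' + i)) := by

  classical
  have hq : 2 ≤ Fintype.card G := Fintype.one_lt_card
  have hq0 : (Fintype.card G : ℚ) ≠ 0 := by
    have : Fintype.card G ≠ 0 := by omega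
    exact_mod_cast this
  -- enumerator of the code
  obtain ⟨A, hA, hA0, hAd, -⟩ := ZetaAux.enum_lemma n d (by omega) (C : Set (Fin n → G))
    (fun c => hammingNorm c) 0 C.zero_mem (by simp)
    (fun c => by simpa using hammingNorm_le_card_fintype (x := c))
    (fun c hc hne => hmin.2 ⟨c, hc, hne, rfl⟩)
  obtain ⟨B, hB, hB0, hBd, hBcard⟩ := ZetaAux.enum_lemma n d' (by omega)
    (dualCodeSet n (C : Set (Fin n → G)))
    (fun c => charWeight c) (fun _ => 1) (by intro c _; simp) (by simp [charWeight])
    (fun c => by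
      rw [charWeight]
      exact (Finite.card_subtype_le _).trans (by simp))
    (fun c hc hne => hmin'.2 ⟨c, hc, hne, rfl⟩)
  change weightEnum n (C : Set (Fin n → G)) = _ at hA
  change dualEnum n (dualCodeSet n (C : Set (Fin n → G))) = _ at hB
  change MvPolynomial.eval _ (dualEnum n (dualCodeSet n (C : Set (Fin n → G)))) = _ at hBcard
  have hdn : d ≤ n := by
    obtain ⟨c, _, _, hc⟩ := hmin.1
    rw [← hc]; simpa using hammingNorm_le_card_fintype (x := c)
  have hdn' : d' ≤ n := by
    obtain ⟨c, _, _, hc⟩ := hmin'.1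
    rw [← hc, charWeight]
    exact (Finite.card_subtype_le _).trans (by simp)
  -- cardinality of the dual
  have hcard : Fintype.card G ^ k * Nat.card (dualCodeSet n (C : Set (Fin n → G)))
      = Fintype.card G ^ n := by
    have h := congrArg (MvPolynomial.eval (fun _ => (1 : ℚ))) hMW
    rw [map_mul, hBcard, hk, hA] at h
    generalize Nat.card (dualCodeSet n (C : Set (Fin n → G))) = N at h ⊢
    rw [ ZetaAux.hom, map_sum, map_sum, Finset.sum_range_succ',
      Finset.sum_eq_zero] at h
    · simp [hA0] at h
      exact_mod_cast h
    · intro s _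
      simp
  -- Singleton bounds
  have hs1 : d + k ≤ n + 1 := by
    have h := ZetaAux.singleton_bound n d (by omega) (C : Set (Fin n → G)) (by
      intro x hx y hy hne
      have := hmin.2 ⟨x - y, C.sub_mem hx hy, sub_ne_zero.mpr hne, rfl⟩
      refine this.trans (le_of_eq ?_)
      rw [hammingNorm, Nat.card_eq_fintype_card, Fintype.card_subtype]
      simp [sub_eq_zero])
    have h2 : Nat.card C ≤ Nat.card G ^ (n + 1 - d) := h
    rw [hk, Nat.card_eq_fintype_card] at h2
    have := (Nat.pow_le_pow_iff_right (by omega)).mp h2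
    omega
  have hs2 : d' ≤ k + 1 := by
    have h := ZetaAux.singleton_bound n d' (by omega) (dualCodeSet n (C : Set (Fin n → G))) (by
      intro x hx y hy hne
      have : d' ≤ charWeight (fun j => x j * (y j)⁻¹) := hmin'.2 ⟨(fun j => x j * (y j)⁻¹), by
        intro c hc
        have h1 := hx c hc
        have h2 := hy (-c) (C.neg_mem hc)
        simp only [AddChar.mul_apply, AddChar.inv_apply, Finset.prod_mul_distrib, h1, one_mul]
        simpa using h2, by
        intro e
        apply hne
        funext j
        exact mul_inv_eq_one.mp (congrFun e j), rfl⟩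
      refine this.trans (le_of_eq ?_)
      simp only [charWeight, ne_eq, mul_inv_eq_one])
    have e : Nat.card (AddChar G ℂ) = Fintype.card G := by
      rw [Nat.card_eq_fintype_card, AddChar.card_eq]
    rw [e] at h
    have h3 : Fintype.card G ^ n ≤ Fintype.card G ^ (k + (n + 1 - d')) := by
      rw [← hcard, pow_add]
      exact Nat.mul_le_mul_left _ h
    have := (Nat.pow_le_pow_iff_right (by omega)).mp h3
    omega
  -- expansion of the enumerator of the code
  obtain ⟨a, ha⟩ := ZetaAux.exists_expand (Fintype.card G) n hq (n + 1 - d) d (by omega)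
    (by omega) A hAd
  have hWC : weightEnum n (C : Set (Fin n → G))
      = ∑ t ∈ Finset.Icc d (n + 1), a t • mdsEnum (Fintype.card G) n t := by
    rw [hA, ZetaAux.hom_congr n _ _ ha, ZetaAux.hom_sum]
    refine Finset.sum_congr rfl fun t ht => ?_
    simp only [Finset.mem_Icc] at ht
    rw [ZetaAux.mds_eq _ _ _ (by omega)]
  set b : ℕ → ℚ := fun u =>
    ((Fintype.card G : ℚ) ^ k)⁻¹ * (a (n + 2 - u) * (Fintype.card G : ℚ) ^ (u - 1)) with hb
  have hWD : dualEnum n (dualCodeSet n (C : Set (Fin n → G)))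
      = ∑ u ∈ Finset.Icc 1 (n + 2 - d), b u • mdsEnum (Fintype.card G) n u := by
    rw [hWC, map_sum, ← MvPolynomial.smul_eq_C_mul, hk] at hMW
    have hne : ((Fintype.card G ^ k : ℕ) : ℚ) ≠ 0 := by
      push_cast; exact pow_ne_zero _ hq0
    rw [← inv_smul_smul₀ hne (dualEnum n (dualCodeSet n (C : Set (Fin n → G)))), hMW,
      Finset.smul_sum]
    refine Finset.sum_bij' (fun t _ => n + 2 - t) (fun u _ => n + 2 - u) ?_ ?_ ?_ ?_ ?_
    · intro t ht; simp only [Finset.mem_Icc] at *; omega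
    · intro t ht; simp only [Finset.mem_Icc] at *; omega
    · intro t ht; simp only [Finset.mem_Icc] at *; omega
    · intro t ht; simp only [Finset.mem_Icc] at *; omega
    · intro t ht
      simp only [Finset.mem_Icc] at ht
      rw [map_smul, ZetaAux.mds_transform _ _ _ (by omega) (by omega), smul_smul, smul_smul, hb]
      simp only
      rw [show n + 2 - (n + 2 - t) = t by omega, show n + 2 - t - 1 = n + 1 - t by omega]
      push_cast
      rw [mul_assoc]
  have hbz := ZetaAux.expand_zero (Fintype.card G) n hq 1 (n + 2 - d) d' le_rfl (by omega) b (by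
    intro s h0 hs hlt
    rw [← hBd s h0 hlt, ← ZetaAux.cf_hom n s B hs, ← hB, hWD, ZetaAux.cf_sum]
    refine Finset.sum_congr rfl fun t ht => ?_
    simp only [Finset.mem_Icc] at ht
    rw [ZetaAux.cf_smul, ZetaAux.cf_mds _ _ _ _ (by omega) hs])
  have haz : ∀ t, n + 2 - d' < t → t ≤ n + 1 → a t = 0 := by
    intro t h1 h2
    have h := hbz (n + 2 - t) (by omega) (by omega) (by omega)
    rw [hb] at h
    simp only [show n + 2 - (n + 2 - t) = t by omega] at h
    simpa [hq0] using h
  have hgg : g + g' = n + 2 - d - d' := by omega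
  refine ⟨ZetaAux.final _ n d (g + g') hq (by omega) (by omega) _ ?_ a ?_,
    ZetaAux.final _ n d' (g + g') hq (by omega) (by omega) _ ?_ b ?_⟩
  · rw [hA, ZetaAux.cf_hom _ _ _ (by omega), hA0]
  · rw [hWC]
    symm
    refine Finset.sum_subset ?_ ?_
    · intro t; simp only [Finset.mem_Icc]; omega
    · intro t h1 h2
      simp only [Finset.mem_Icc] at h1 h2
      rw [haz t (by omega) (by omega), zero_smul]
  · rw [hB, ZetaAux.cf_hom _ _ _ (by omega), hB0]
  · rw [hWD]
    symm
    refine Finset.sum_subset ?_ ?_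
    · intro t; simp only [Finset.mem_Icc]; omega
    · intro t h1 h2
      simp only [Finset.mem_Icc] at h1 h2
      rw [hbz t (by omega) (by omega) (by omega), zero_smul]
end

section
/- Let C ≤ G^n be an additive code of genus g and minimum distance d ≥ 2 with dual C⊥ of genus g⊥ and minimum distance d⊥ ≥ 2, and let P_C(t), P_{C⊥}(t) be their ζ-polynomials. The MacWilliams identity |C|·W_{C⊥}(x,y) = W_C(x + (|G|−1)y, x−y) holds if and only if P_{C⊥}(t) = P_C(1/(|G|t)) · |G|^g · t^{g+g⊥}. -/
open MvPolynomial

theorem zf_pascal (v : ℕ) (f : ℕ → ℚ) :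
    ∑ i ∈ Finset.range (v + 2), (-1 : ℚ) ^ i * ((v + 1).choose i : ℚ) * f (v + 1 - i)
      = ∑ i ∈ Finset.range (v + 1), (-1 : ℚ) ^ i * (v.choose i : ℚ) * (f (v + 1 - i) - f (v - i)) := by
  rw [Finset.sum_range_succ']
  have h1 : ∀ i ∈ Finset.range (v + 1),
      (-1 : ℚ) ^ (i + 1) * ((v + 1).choose (i + 1) : ℚ) * f (v + 1 - (i + 1))
      = (-1 : ℚ) ^ (i + 1) * (v.choose (i + 1) : ℚ) * f (v + 1 - (i + 1))
        - (-1 : ℚ) ^ i * (v.choose i : ℚ) * f (v - i) := by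
    intro i _
    rw [Nat.choose_succ_succ, Nat.add_sub_add_right]
    push_cast
    ring
  rw [Finset.sum_congr rfl h1, Finset.sum_sub_distrib]
  have h2 := Finset.sum_range_succ' (fun i => (-1 : ℚ) ^ i * (v.choose i : ℚ) * f (v + 1 - i)) (v + 1)
  rw [Finset.sum_range_succ] at h2
  simp only [Nat.choose_succ_self, Nat.cast_zero, mul_zero, zero_mul, add_zero] at h2
  simp only [mul_sub, Finset.sum_sub_distrib]
  rw [h2]
  simp
  ring

theorem zf_coef (q s v : ℕ) (hs : 1 ≤ s) :
    ∑ i ∈ Finset.range (v + 2), (-1 : ℚ) ^ i * ((v + 1).choose i : ℚ) * (q : ℚ) ^ (v + 1 - i + 1 - s)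
      = if s ≤ v + 1 then ((q : ℚ) - 1) *
        ∑ i ∈ Finset.range (v + 1 - s + 1),
          (-1 : ℚ) ^ i * (v.choose i : ℚ) * (q : ℚ) ^ (v + 1 - s - i) else 0 := by
  rw [zf_pascal v (fun j => (q : ℚ) ^ (j + 1 - s))]
  have key : ∀ i ∈ Finset.range (v + 1), (-1 : ℚ) ^ i * (v.choose i : ℚ) *
      ((q : ℚ) ^ (v + 1 - i + 1 - s) - (q : ℚ) ^ (v - i + 1 - s)) =
      if i + s ≤ v + 1 then ((q : ℚ) - 1) * ((-1 : ℚ) ^ i * (v.choose i : ℚ) * (q : ℚ) ^ (v + 1 - s - i))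
      else 0 := by
    intro i hi
    rw [Finset.mem_range] at hi
    split_ifs with h
    · rw [show v + 1 - i + 1 - s = (v + 1 - s - i) + 1 by omega,
        show v - i + 1 - s = v + 1 - s - i by omega]
      ring
    · rw [show v + 1 - i + 1 - s = 0 by omega, show v - i + 1 - s = 0 by omega]
      simp
  rw [Finset.sum_congr rfl key]
  split_ifs with h
  · rw [Finset.mul_sum, ← Finset.sum_filter]
    apply Finset.sum_congr _ (fun _ _ => rfl)
    ext i
    simp only [Finset.mem_filter, Finset.mem_range]
    omega
  · apply Finset.sum_eq_zero
    intro i _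
    rw [if_neg (by omega)]

theorem zf_expand (n : ℕ) (f : ℕ → ℚ) :
    ∑ j ∈ Finset.range (n + 1), (MvPolynomial.C ((n.choose j : ℚ) * f j) *
        (X 0 - X 1) ^ (n - j) * X 1 ^ j : MvPolynomial (Fin 2) ℚ)
      = ∑ w ∈ Finset.range (n + 1), MvPolynomial.C ((n.choose w : ℚ) *
          ∑ i ∈ Finset.range (w + 1), (-1 : ℚ) ^ i * (w.choose i : ℚ) * f (w - i)) *
            X 0 ^ (n - w) * X 1 ^ w := by
  have h1 : ∀ j ∈ Finset.range (n + 1), (MvPolynomial.C ((n.choose j : ℚ) * f j) *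
        (X 0 - X 1) ^ (n - j) * X 1 ^ j : MvPolynomial (Fin 2) ℚ)
      = ∑ m ∈ Finset.range (n + 1 - j), MvPolynomial.C ((n.choose (j + m) : ℚ) *
          ((-1 : ℚ) ^ m * ((j + m).choose m : ℚ) * f j)) * X 0 ^ (n - (j + m)) * X 1 ^ (j + m) := by
    intro j hj
    rw [Finset.mem_range] at hj
    rw [show (X 0 - X 1 : MvPolynomial (Fin 2) ℚ) = (-X 1) + X 0 by ring, add_pow,
      Finset.mul_sum, Finset.sum_mul, show n - j + 1 = n + 1 - j by omega]
    apply Finset.sum_congr rfl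
    intro m hm
    rw [Finset.mem_range] at hm
    have hc : (n.choose (j + m) : ℚ) * ((j + m).choose m : ℚ) = n.choose j * (n - j).choose m := by
      have := Nat.choose_mul (n := n) (k := j + m) (s := j) (by omega)
      rw [Nat.add_sub_cancel_left, ← Nat.choose_symm_of_eq_add (show j + m = m + j by omega)] at this
      exact_mod_cast this
    rw [show (n.choose (j + m) : ℚ) * ((-1 : ℚ) ^ m * ((j + m).choose m : ℚ) * f j)
      = (n.choose j * (n - j).choose m) * ((-1) ^ m * f j) by rw [← hc]; ring]
    rw [show n - (j + m) = n - j - m by omega, neg_pow]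
    simp only [map_mul, map_pow, map_neg, map_one, map_natCast]
    ring
  rw [Finset.sum_congr rfl h1, ← Finset.sum_range_diag_flip (n + 1) (fun j m =>
    (MvPolynomial.C ((n.choose (j + m) : ℚ) *
          ((-1 : ℚ) ^ m * ((j + m).choose m : ℚ) * f j)) * X 0 ^ (n - (j + m)) * X 1 ^ (j + m) :
          MvPolynomial (Fin 2) ℚ))]
  apply Finset.sum_congr rfl
  intro w _
  rw [← Finset.sum_range_reflect, Finset.mul_sum, map_sum, Finset.sum_mul, Finset.sum_mul]
  apply Finset.sum_congr rfl
  intro i hi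
  rw [Finset.mem_range] at hi
  rw [show w + 1 - 1 - i + (w - (w + 1 - 1 - i)) = w by omega,
    show w - (w + 1 - 1 - i) = i by omega, show w + 1 - 1 - i = w - i by omega]

theorem zf_mds (q n s : ℕ) (hs : 1 ≤ s) :
    mdsEnum q n s = ∑ j ∈ Finset.range (n + 1),
      (MvPolynomial.C ((n.choose j : ℚ) * (q : ℚ) ^ (j + 1 - s)) *
        (X 0 - X 1) ^ (n - j) * X 1 ^ j : MvPolynomial (Fin 2) ℚ) := by
  rw [zf_expand n (fun j => (q : ℚ) ^ (j + 1 - s)), Finset.sum_range_succ', add_comm]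
  unfold mdsEnum
  congr 1
  · simp [show 1 - s = 0 by omega]
  · simp only [zf_coef q s _ hs]
    rw [← Finset.sum_subset (s₁ := (Finset.Icc s n).image (fun w => w - 1)) (s₂ := Finset.range n)]
    · rw [Finset.sum_image]
      · apply Finset.sum_congr rfl
        intro w hw
        rw [Finset.mem_Icc] at hw
        rw [show w - 1 + 1 = w by omega, if_pos hw.1, mul_assoc (n.choose w : ℚ)]
      · intro a ha b hb hab
        simp only [Finset.coe_Icc, Set.mem_Icc] at ha hb hab
        omega
    · intro w hw
      simp only [Finset.mem_image, Finset.mem_Icc, Finset.mem_range] at hw ⊢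
      omega
    · intro w hw hw2
      rw [if_neg]
      · simp
      · intro hsw
        apply hw2
        rw [Finset.mem_range] at hw
        exact Finset.mem_image.2 ⟨w + 1, Finset.mem_Icc.2 ⟨hsw, by omega⟩, by omega⟩

theorem zf_transform (q n s : ℕ) (hs : 1 ≤ s) (hn : s ≤ n + 1) :
    MvPolynomial.bind₁ (fun j : Fin 2 => if j = 0 then
              X 0 + MvPolynomial.C ((q : ℚ) - 1) * X 1
            else X 0 - X 1) (mdsEnum q n s) = (q : ℚ) ^ (n + 1 - s) • mdsEnum q n (n + 2 - s) := by
  rw [zf_mds q n s hs, zf_mds q n _ (by omega), map_sum, ← Finset.sum_range_reflect,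
    Finset.smul_sum]
  apply Finset.sum_congr rfl
  intro j hj
  rw [Finset.mem_range] at hj
  rw [show n + 1 - 1 - j = n - j by omega, show n - (n - j) = j by omega,
    Nat.choose_symm (by omega : j ≤ n)]
  simp only [map_mul, map_pow, map_sub, bind₁_X_right, if_true, one_ne_zero, if_false,
    MvPolynomial.smul_eq_C_mul, map_one, map_natCast]
  rw [show (X 0 + ((q : MvPolynomial (Fin 2) ℚ) - 1) * X 1 - (X 0 - X 1) : MvPolynomial (Fin 2) ℚ)
    = (q : MvPolynomial (Fin 2) ℚ) * X 1 by ring, mul_pow]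
  have : (q : MvPolynomial (Fin 2) ℚ) ^ (n - j + 1 - s) * (q : MvPolynomial (Fin 2) ℚ) ^ j
    = (q : MvPolynomial (Fin 2) ℚ) ^ (n + 1 - s) * (q : MvPolynomial (Fin 2) ℚ) ^ (j + 1 - (n + 2 - s)) := by
    rw [← pow_add, ← pow_add]
    congr 1
    omega
  linear_combination ((n.choose j : MvPolynomial (Fin 2) ℚ) * (X 0 - X 1) ^ (n - j) * X 1 ^ j) * this

theorem zf_aeval_coeff (q n t s : ℕ) (hs : 1 ≤ s) :
    ((MvPolynomial.aeval (fun j : Fin 2 => if j = 0 then (1 : Polynomial ℚ) else Polynomial.X))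
      (mdsEnum q n t)).coeff s = if t ≤ s ∧ s ≤ n then (n.choose s : ℚ) * ((q : ℚ) - 1) *
        ∑ i ∈ Finset.range (s - t + 1),
          (-1 : ℚ) ^ i * ((s - 1).choose i : ℚ) * (q : ℚ) ^ (s - t - i) else 0 := by
  have hs0 : s ≠ 0 := by omega
  unfold mdsEnum
  simp only [map_add, map_sum, map_pow, MvPolynomial.aeval_X, if_true, one_pow,
    Polynomial.coeff_add, Polynomial.coeff_one, hs0, if_false, zero_add, Polynomial.finsetSum_coeff]
  have h : ∀ x ∈ Finset.Icc t n, ((MvPolynomial.aeval (fun j : Fin 2 => if j = 0 then (1 : Polynomial ℚ) else Polynomial.X))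
      (MvPolynomial.C ((n.choose x : ℚ) * ((q : ℚ) - 1) *
        ∑ i ∈ Finset.range (x - t + 1),
          (-1 : ℚ) ^ i * ((x - 1).choose i : ℚ) * (q : ℚ) ^ (x - t - i)) *
      X 0 ^ (n - x) * X 1 ^ x)).coeff s = if s = x then (n.choose x : ℚ) * ((q : ℚ) - 1) *
        ∑ i ∈ Finset.range (x - t + 1),
          (-1 : ℚ) ^ i * ((x - 1).choose i : ℚ) * (q : ℚ) ^ (x - t - i) else 0 := by
    intro x _
    generalize ((n.choose x : ℚ) * ((q : ℚ) - 1) *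
        ∑ i ∈ Finset.range (x - t + 1),
          (-1 : ℚ) ^ i * ((x - 1).choose i : ℚ) * (q : ℚ) ^ (x - t - i)) = z
    rw [map_mul, map_mul, map_pow, map_pow, MvPolynomial.aeval_X, MvPolynomial.aeval_X,
      MvPolynomial.aeval_C, ← Polynomial.C_eq_algebraMap, if_pos rfl, if_neg one_ne_zero, one_pow,
      mul_one, Polynomial.coeff_C_mul, Polynomial.coeff_X_pow]
    simp
  have h' := Finset.sum_congr (rfl : Finset.Icc t n = _) h
  simp only [Finset.sum_ite_eq, Finset.mem_Icc] at h'
  rw [← h']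

theorem zf_indep (q n t N : ℕ) (hq : 2 ≤ q) (ht : 1 ≤ t) (hn : t + N ≤ n) (a : ℕ → ℚ)
    (h : ∑ i ∈ Finset.range (N + 1), a i • mdsEnum q n (t + i) = 0) : ∀ i ≤ N, a i = 0 := by
  have h2 := congrArg (MvPolynomial.aeval (fun j : Fin 2 => if j = 0 then (1 : Polynomial ℚ) else Polynomial.X)) h
  rw [map_sum, map_zero] at h2
  intro i
  induction i using Nat.strong_induction_on with
  | _ i ih =>
  intro hi
  have h3 := congrArg (fun p => Polynomial.coeff p (t + i)) h2
  simp only [map_smul, Polynomial.finsetSum_coeff, Polynomial.coeff_smul, Polynomial.coeff_zero] at h3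
  rw [Finset.sum_eq_single i] at h3
  · rw [smul_eq_mul, mul_eq_zero] at h3
    refine h3.resolve_right ?_
    have hq' : (q : ℚ) - 1 ≠ 0 := by
      have : (2 : ℚ) ≤ q := by exact_mod_cast hq
      intro h; linarith
    have hc : (n.choose (t + i) : ℚ) ≠ 0 := by
      exact_mod_cast (Nat.choose_pos (by omega)).ne'
    rw [zf_aeval_coeff _ _ _ _ (by omega), if_pos ⟨le_rfl, by omega⟩]
    simp [hq', hc]
  · intro b hb hbi
    rcases lt_or_gt_of_ne hbi with hlt | hgt
    · rw [ih b hlt (by omega), zero_smul]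
    · rw [zf_aeval_coeff _ _ _ _ (by omega), if_neg (by omega), smul_zero]
  · intro h; exact absurd (Finset.mem_range.2 (by omega)) h

theorem zf_singleton {G : Type*} [AddCommGroup G] [Fintype G] [DecidableEq G] [Nontrivial G]
    (n k d : ℕ) (hd : 1 ≤ d) (C : AddSubgroup (Fin n → G))
    (hk : Nat.card C = Fintype.card G ^ k)
    (hmin : IsLeast {w | ∃ c ∈ C, c ≠ 0 ∧ hammingNorm c = w} d) : k + d ≤ n + 1 := by
  obtain ⟨c0, hc0, hne, hw⟩ := hmin.1
  have hdn : d ≤ n := by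
    rw [← hw]; simpa using hammingNorm_le_card_fintype (x := c0)
  let r : C → (Fin (n + 1 - d) → G) := fun c j => c.1 ⟨j.1, by omega⟩
  have hr : Function.Injective r := by
    intro c e hce
    by_contra hne
    have hsub : (c.1 - e.1) ≠ 0 := by
      intro h; exact hne (Subtype.ext (sub_eq_zero.1 h))
    have h1 : d ≤ hammingNorm (c.1 - e.1) := hmin.2 ⟨_, C.sub_mem c.2 e.2, hsub, rfl⟩
    have h2 : hammingNorm (c.1 - e.1) ≤ (Finset.univ.filter (fun j : Fin n => n + 1 - d ≤ j.1)).card := by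
      apply Finset.card_le_card
      intro j hj
      simp only [Finset.mem_filter, Finset.mem_univ, true_and] at hj ⊢
      by_contra hlt
      apply hj
      have := congrFun hce ⟨j.1, by omega⟩
      simpa [r, sub_eq_zero] using this
    have h3 : (Finset.univ.filter (fun j : Fin n => n + 1 - d ≤ j.1)).card ≤ d - 1 := by
      have : ((Finset.univ.filter (fun j : Fin n => n + 1 - d ≤ j.1)).map Fin.valEmbedding) ⊆ Finset.Ico (n + 1 - d) n := by
        intro x hx
        simp only [Finset.mem_map, Finset.mem_filter, Finset.mem_univ, true_and] at hx
        obtain ⟨j, hj, rfl⟩ := hx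
        simp [hj]
      have := Finset.card_le_card this
      rw [Finset.card_map, Nat.card_Ico] at this
      omega
    omega
  have h := Nat.card_le_card_of_injective r hr
  rw [hk, Nat.card_eq_fintype_card, Fintype.card_fun, Fintype.card_fin] at h
  have := (Nat.pow_le_pow_iff_right (Fintype.one_lt_card (α := G))).1 h
  omega

theorem zf_singleton' {G : Type*} [AddCommGroup G] [Fintype G] [DecidableEq G] [Nontrivial G]
    (n k d' : ℕ) (C : AddSubgroup (Fin n → G))
    (hk : Nat.card C = Fintype.card G ^ k)
    (hmin' : IsLeast {w | ∃ π ∈ dualCodeSet n (C : Set (Fin n → G)),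
      π ≠ (fun _ => 1) ∧ charWeight π = w} d') : d' ≤ k + 1 := by
  by_contra hlt
  obtain ⟨π0, -, -, hw⟩ := hmin'.1
  have hdn : d' ≤ n := by
    rw [← hw]; unfold charWeight
    simpa using Nat.card_le_card_of_injective (Subtype.val : {j : Fin n // π0 j ≠ 1} → Fin n) Subtype.val_injective
  let r : (Fin n → G) →+ (Fin (k + 1) → G) :=
    { toFun := fun c j => c ⟨j.1, by omega⟩
      map_zero' := rfl
      map_add' := fun _ _ => rfl }
  have hHc : Nat.card (C.map r) ≤ Fintype.card G ^ k := by
    rw [← hk]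
    exact Nat.card_le_card_of_surjective (r.addSubgroupMap C) (r.addSubgroupMap_surjective C)
  have hH : C.map r ≠ ⊤ := by
    intro h
    rw [h, AddSubgroup.card_top, Nat.card_eq_fintype_card, Fintype.card_fun, Fintype.card_fin] at hHc
    have := (Nat.pow_le_pow_iff_right (Fintype.one_lt_card (α := G))).1 hHc
    omega
  obtain ⟨x, hx⟩ : ∃ x, x ∉ C.map r := by
    by_contra hcon
    push Not at hcon
    exact hH (eq_top_iff.2 fun y _ => hcon y)
  have hx0 : (QuotientAddGroup.mk' (C.map r) x) ≠ 0 := by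
    simpa using hx
  haveI : Finite ((Fin (k + 1) → G) ⧸ C.map r) := inferInstance
  obtain ⟨ψ, hψ⟩ := (AddChar.exists_apply_ne_zero (α := (Fin (k + 1) → G) ⧸ C.map r)).2 hx0
  let χ : AddChar (Fin n → G) ℂ := ψ.compAddMonoidHom ((QuotientAddGroup.mk' (C.map r)).comp r)
  let π : Fin n → AddChar G ℂ := fun j => χ.compAddMonoidHom (AddMonoidHom.single (fun _ => G) j)
  have hprod : ∀ c : Fin n → G, ∏ j, π j (c j) = χ c := by
    intro c
    conv_rhs => rw [← Finset.univ_sum_single c]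
    exact (map_prod χ.toMonoidHom (fun j => Multiplicative.ofAdd (Pi.single j (c j) : Fin n → G)) Finset.univ).symm
  have hrs : Function.Surjective r := by
    intro y
    refine ⟨fun j => if h : j.1 < k + 1 then y ⟨j.1, h⟩ else 0, ?_⟩
    ext j
    simp only [r, AddMonoidHom.coe_mk, ZeroHom.coe_mk]
    rw [dif_pos j.2]
  have hmem : π ∈ dualCodeSet n (C : Set (Fin n → G)) := by
    intro c hc
    rw [hprod]
    have : QuotientAddGroup.mk' (C.map r) (r c) = 0 := by
      rw [QuotientAddGroup.mk'_apply, QuotientAddGroup.eq_zero_iff]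
      exact ⟨c, hc, rfl⟩
    change ψ (QuotientAddGroup.mk' (C.map r) (r c)) = 1
    rw [this, AddChar.map_zero_eq_one]
  have hne : π ≠ fun _ => 1 := by
    intro h
    obtain ⟨y, rfl⟩ := hrs x
    apply hψ
    have := hprod y
    rw [h] at this
    change χ y = 1
    rw [← this]
    simp
  have hle : d' ≤ charWeight π := hmin'.2 ⟨π, hmem, hne, rfl⟩
  have hle2 : charWeight π ≤ k + 1 := by
    unfold charWeight
    have hlt' : ∀ j : {j : Fin n // π j ≠ 1}, j.1.1 < k + 1 := by
      rintro ⟨j, hj⟩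
      by_contra hcon
      apply hj
      ext a
      change ψ (QuotientAddGroup.mk' (C.map r) (r (Pi.single j a))) = 1
      have : r (Pi.single j a) = 0 := by
        ext i
        change (Pi.single j a : Fin n → G) ⟨i.1, _⟩ = 0
        apply Pi.single_eq_of_ne
        intro h
        have h' := congrArg Fin.val h
        have := i.2
        simp only at h' hcon
        omega
      rw [this, map_zero, AddChar.map_zero_eq_one]
    have := Nat.card_le_card_of_injective (fun j : {j : Fin n // π j ≠ 1} => (⟨j.1.1, hlt' j⟩ : Fin (k + 1)))
      (by
        intro a b hab
        have := congrArg Fin.val hab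
        exact Subtype.ext (Fin.ext this))
    simpa using this
  omega

/-- With `P_C`, `P_{C⊥}` the ζ-polynomials of an additive code
`C ≤ Gⁿ` and its dual (characterized by degree `≤ g+g⊥`, value `1` at `t=1` and the
MDS-enumerator expansions of the weight enumerators), the MacWilliams identity
`|C|·W_{C⊥}(x,y) = W_C(x+(|G|-1)y, x-y)` holds if and only if the functional equation
`P_{C⊥}(t) = P_C(1/(|G|t))·|G|^g·t^(g+g⊥)` holds; coefficientwise the latter reads
`|G|^{g⊥}·a⊥_i = |G|^i·a_{g+g⊥-i}` for all `0 ≤ i ≤ g+g⊥`. -/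
theorem MacWilliams_iff_zeta_functional_equation {G : Type*} [AddCommGroup G] [Fintype G]
    [DecidableEq G] [Nontrivial G]
    (n k d d' g g' : ℕ) (hd : 2 ≤ d) (hd' : 2 ≤ d')
    (C : AddSubgroup (Fin n → G))
    (hk : Nat.card C = Fintype.card G ^ k)
    (hmin : IsLeast {w | ∃ c ∈ C, c ≠ 0 ∧ hammingNorm c = w} d)
    (hmin' : IsLeast {w | ∃ π ∈ dualCodeSet n (C : Set (Fin n → G)),
      π ≠ (fun _ => 1) ∧ charWeight π = w} d')
    (hg : g = n + 1 - d - k) (hg' : g' = k + 1 - d')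
    (P P' : Polynomial ℚ)
    (hP : P.natDegree ≤ g + g' ∧ P.eval 1 = 1 ∧
      weightEnum n (C : Set (Fin n → G))
        = ∑ i ∈ Finset.range (g + g' + 1),
            P.coeff i • mdsEnum (Fintype.card G) n (d + i))
    (hP' : P'.natDegree ≤ g + g' ∧ P'.eval 1 = 1 ∧
      dualEnum n (dualCodeSet n (C : Set (Fin n → G)))
        = ∑ i ∈ Finset.range (g + g' + 1),
            P'.coeff i • mdsEnum (Fintype.card G) n (d' + i)) :
    (MvPolynomial.C ((Nat.card C : ℚ)) *
        dualEnum n (dualCodeSet n (C : Set (Fin n → G)))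
      = MvPolynomial.bind₁
          (fun j : Fin 2 => if j = 0 then
              X 0 + MvPolynomial.C ((Fintype.card G : ℚ) - 1) * X 1
            else X 0 - X 1)
          (weightEnum n (C : Set (Fin n → G))))
      ↔ (∀ i ≤ g + g',
          (Fintype.card G : ℚ) ^ g' * P'.coeff i
            = (Fintype.card G : ℚ) ^ i * P.coeff (g + g' - i)) := by
  have hq : 2 ≤ Fintype.card G := Fintype.one_lt_card
  have hs1 := zf_singleton n k d (by omega) C hk hmin
  have hs2 := zf_singleton' n k d' C hk hmin'
  have hq0 : (Fintype.card G : ℚ) ≠ 0 := by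
    have : Fintype.card G ≠ 0 := by omega
    exact_mod_cast this
  rw [hP.2.2, hP'.2.2, map_sum, hk]
  have hR : ∑ i ∈ Finset.range (g + g' + 1), MvPolynomial.bind₁
          (fun j : Fin 2 => if j = 0 then
              X 0 + MvPolynomial.C ((Fintype.card G : ℚ) - 1) * X 1
            else X 0 - X 1) (P.coeff i • mdsEnum (Fintype.card G) n (d + i))
      = ∑ i ∈ Finset.range (g + g' + 1), ((Fintype.card G : ℚ) ^ (d' + i - 1) *
          P.coeff (g + g' - i)) • mdsEnum (Fintype.card G) n (d' + i) := by
    rw [← Finset.sum_range_reflect]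
    apply Finset.sum_congr rfl
    intro i hi
    rw [Finset.mem_range] at hi
    rw [map_smul, zf_transform _ _ _ (by omega) (by omega), smul_smul, mul_comm]
    rw [show n + 1 - (d + (g + g' + 1 - 1 - i)) = d' + i - 1 by omega,
      show n + 2 - (d + (g + g' + 1 - 1 - i)) = d' + i by omega,
      show g + g' + 1 - 1 - i = g + g' - i by omega]
  have hL : MvPolynomial.C (((Fintype.card G ^ k : ℕ) : ℚ)) * ∑ i ∈ Finset.range (g + g' + 1),
            P'.coeff i • mdsEnum (Fintype.card G) n (d' + i)
      = ∑ i ∈ Finset.range (g + g' + 1), ((Fintype.card G : ℚ) ^ k *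
          P'.coeff i) • mdsEnum (Fintype.card G) n (d' + i) := by
    rw [← MvPolynomial.smul_eq_C_mul, Finset.smul_sum]
    apply Finset.sum_congr rfl
    intro i _
    rw [smul_smul]
    push_cast
    rfl
  rw [hR, hL]
  have hcoef : ∀ i, ((Fintype.card G : ℚ) ^ k * P'.coeff i
        = (Fintype.card G : ℚ) ^ (d' + i - 1) * P.coeff (g + g' - i)) ↔
      ((Fintype.card G : ℚ) ^ g' * P'.coeff i = (Fintype.card G : ℚ) ^ i * P.coeff (g + g' - i)) := by
    intro i
    rw [show k = (d' - 1) + g' by omega, show d' + i - 1 = (d' - 1) + i by omega,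
      pow_add, pow_add, mul_assoc, mul_assoc]
    exact mul_right_inj' (pow_ne_zero _ hq0)
  constructor
  · intro h i hi
    rw [← hcoef]
    rw [← sub_eq_zero, ← Finset.sum_sub_distrib] at h
    simp only [← sub_smul] at h
    exact sub_eq_zero.1 (zf_indep (Fintype.card G) n d' (g + g') hq (by omega) (by omega) _ h i hi)
  · intro h
    apply Finset.sum_congr rfl
    intro i hi
    rw [(hcoef i).2 (h i (by rw [Finset.mem_range] at hi; omega))]
end

section
/- Let C ≤ G^n be an additive code of cardinality |G|^k and minimum distance d ≥ 2 with dual of minimum distance d⊥ ≥ 2, and let g = n+1−d−k, g⊥ = k+1−d⊥. Then there is a unique polynomial D_C(t) = ∑_{i=0}^{g+g⊥−2} c_i t^i ∈ ℚ[t] such that W_C(x,y) = M_{n,n+1−k}(x,y) + ∑_{i=0}^{g+g⊥−2} [C(n,d+i)(|G|−1) c_i] (x−y)^{n−d−i} y^{d+i}, and its coefficients satisfy (|G|−1)·C(n,d+i)·c_i = ∑_{s=0}^{d+i} (W_C^{(s)} − M_{n,n+1−k}^{(s)})·C(n−s, n−d−i) ∈ ℤ for all 0 ≤ i ≤ g+g⊥−2.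 -/
open MvPolynomial

/-- The coefficient of `x^(n-s) y^s` in the MDS weight enumerator `M_{n,d}` over a
group of order `q` (an integer). -/
noncomputable def mdsCoeff (q n d s : ℕ) : ℤ :=
  if s = 0 then 1 else if s < d then 0 else
    (n.choose s : ℤ) * ((q : ℤ) - 1) *
      ∑ i ∈ Finset.range (s - d + 1),
        (-1 : ℤ) ^ i * ((s - 1).choose i : ℤ) * (q : ℤ) ^ (s - d - i)

lemma orth (j m : ℕ) : ∑ t ∈ Finset.range (j+1), (-1:ℤ)^t * (j.choose t) * (t.choose m)
    = if j = m then (-1)^m else 0 := by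
  by_cases hjm : j < m
  · rw [if_neg (by omega)]
    apply Finset.sum_eq_zero
    intro t ht
    rw [Finset.mem_range] at ht
    rw [Nat.choose_eq_zero_of_lt (show t < m by omega)]; simp
  push Not at hjm
  obtain ⟨r, rfl⟩ := Nat.exists_eq_add_of_le hjm
  rw [show m + r + 1 = m + (r+1) by ring, Finset.sum_range_add]
  rw [Finset.sum_eq_zero]
  · have h : ∀ x ∈ Finset.range (r+1), (-1:ℤ)^(m+x) * ((m+r).choose (m+x)) * ((m+x).choose m)
       = (-1)^m * ((m+r).choose m) * ((-1)^x * (r.choose x)) := by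
      intro x hx
      rw [Finset.mem_range] at hx
      have := Nat.choose_mul (n := m+r) (k := m+x) (s := m) (by omega)
      rw [Nat.add_sub_cancel_left, Nat.add_sub_cancel_left] at this
      have h2 : (((m+r).choose (m+x) : ℕ) : ℤ) * ((m+x).choose m) = ((m+r).choose m) * (r.choose x) := by
        exact_mod_cast this
      rw [mul_assoc, h2]; ring
    rw [zero_add, Finset.sum_congr rfl h, ← Finset.mul_sum, Int.alternating_sum_range_choose]
    by_cases hr : r = 0
    · subst hr; simp
    · rw [if_neg hr, if_neg (by omega)]; simp
  · intro t ht
    rw [Finset.mem_range] at ht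
    rw [Nat.choose_eq_zero_of_lt ht]; simp

lemma Hid (m j : ℕ) : ∑ t ∈ Finset.range j, (-1:ℤ)^t * (j.choose (t+1)) * (t.choose m)
    = if m < j then (-1)^m else 0 := by
  induction j with
  | zero => simp
  | succ j ih =>
    have h : ∀ t ∈ Finset.range (j+1), (-1:ℤ)^t * ((j+1).choose (t+1)) * (t.choose m)
      = (-1:ℤ)^t * (j.choose t) * (t.choose m) + (-1:ℤ)^t * (j.choose (t+1)) * (t.choose m) := by
      intro t _
      rw [Nat.choose_succ_succ]; push_cast; ring
    rw [Finset.sum_congr rfl h, Finset.sum_add_distrib, orth, Finset.sum_range_succ, ih]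
    rw [Nat.choose_eq_zero_of_lt (show j < j+1 by omega)]
    split_ifs <;> first | omega | simp

lemma Fid (q : ℤ) (j r : ℕ) : ∀ m, m + r = j → (q-1) * ∑ t ∈ Finset.range j, (j.choose (t+1) : ℤ) *
    (if t < m then 0 else ∑ i ∈ Finset.range (t - m + 1), (-1:ℤ)^i * (t.choose i) * q^(t-m-i))
     = q^(j-m) - 1 := by
  induction r with
  | zero =>
    intro m hm
    rw [Finset.sum_eq_zero]
    · simp [← hm]
    · intro t ht
      rw [Finset.mem_range] at ht
      rw [if_pos (by omega), mul_zero]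
  | succ r ih =>
    intro m hm
    have h1 := ih (m+1) (by omega)
    have h2 := Hid m j
    rw [if_pos (by omega)] at h2
    have h : ∀ t ∈ Finset.range j, (j.choose (t+1) : ℤ) *
    (if t < m then 0 else ∑ i ∈ Finset.range (t - m + 1), (-1:ℤ)^i * (t.choose i) * q^(t-m-i))
      = q * ((j.choose (t+1) : ℤ) *
    (if t < m+1 then 0 else ∑ i ∈ Finset.range (t - (m+1) + 1), (-1:ℤ)^i * (t.choose i) * q^(t-(m+1)-i)))
     + (-1)^m * ((-1:ℤ)^t * (j.choose (t+1)) * (t.choose m)) := by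
      intro t _
      rcases lt_trichotomy t m with htm | rfl | htm
      · rw [if_pos htm, if_pos (by omega), Nat.choose_eq_zero_of_lt htm]; simp
      · have : (-1:ℤ)^t * (-1)^t = 1 := by rw [← mul_pow]; simp
        simp
        linear_combination (-(j.choose (t+1) : ℤ)) * this
      · obtain ⟨u, rfl⟩ := Nat.exists_eq_add_of_lt htm
        rw [if_neg (by omega), if_neg (by omega)]
        rw [show m + u + 1 - m = u + 1 by omega, show m + u + 1 - (m+1) = u by omega]
        rw [Finset.sum_range_succ]
        have e : ∑ x ∈ Finset.range (u + 1), (-1:ℤ) ^ x * ((m + u + 1).choose x) * q ^ (u + 1 - x)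
          = q * ∑ x ∈ Finset.range (u + 1), (-1:ℤ) ^ x * ((m + u + 1).choose x) * q ^ (u - x) := by
          rw [Finset.mul_sum]
          apply Finset.sum_congr rfl
          intro x hx
          rw [Finset.mem_range] at hx
          rw [show u + 1 - x = (u - x) + 1 by omega]; ring
        rw [e]
        have e2 : (m+u+1).choose (u+1) = (m+u+1).choose m := by
          rw [← Nat.choose_symm_of_eq_add]; omega
        rw [e2]
        have e3 : (-1:ℤ)^m * (-1)^(m+u+1) = (-1)^(u+1) := by
          have : (-1:ℤ)^m * (-1)^m = 1 := by rw [← mul_pow]; simp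
          rw [add_assoc, pow_add, ← mul_assoc, this, one_mul]
        rw [← e3]; simp; ring
    have h3 : (-1:ℤ)^m * (-1)^m = 1 := by rw [← mul_pow]; simp
    rw [Finset.sum_congr rfl h, Finset.sum_add_distrib, ← Finset.mul_sum, ← Finset.mul_sum, h2, h3]
    rw [show j - m = j - (m+1) + 1 by omega, pow_succ]
    linear_combination q * h1

/-- `M` moments. -/
lemma mds_moment (q n m j : ℕ) (hj : j ≤ n) :
    ∑ s ∈ Finset.range (j+1), mdsCoeff q n (m+1) s * ((n-s).choose (n-j) : ℤ)
      = (n.choose j : ℤ) * (q:ℤ)^(j-m) := by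
  rw [Finset.sum_range_succ']
  have h0 : mdsCoeff q n (m+1) 0 * ((n-0).choose (n-j) : ℤ) = n.choose j := by
    simp [mdsCoeff, Nat.choose_symm hj]
  have h : ∀ t ∈ Finset.range j, mdsCoeff q n (m+1) (t+1) * ((n-(t+1)).choose (n-j) : ℤ)
     = (n.choose j : ℤ) * (((q:ℤ)-1) * ((j.choose (t+1) : ℤ) *
    (if t < m then 0 else ∑ i ∈ Finset.range (t - m + 1), (-1:ℤ)^i * (t.choose i) * (q:ℤ)^(t-m-i)))) := by
    intro t ht
    rw [Finset.mem_range] at ht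
    unfold mdsCoeff
    rw [if_neg (by omega)]
    by_cases htm : t < m
    · rw [if_pos (by omega), if_pos htm]; simp
    · rw [if_neg (by omega), if_neg htm]
      have := Nat.choose_mul (n := n) (k := j) (s := t+1) (by omega)
      have h2 : (n-(t+1)).choose (n-j) = (n-(t+1)).choose (j-(t+1)) := by
        rw [← Nat.choose_symm_of_eq_add]; omega
      rw [← h2] at this
      have h3 : (n.choose j : ℤ) * (j.choose (t+1)) = n.choose (t+1) * (n-(t+1)).choose (n-j) := by
        exact_mod_cast this
      simp only [Nat.add_sub_add_right, Nat.add_sub_cancel]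
      linear_combination (-((q:ℤ)-1) * ∑ i ∈ Finset.range (t - m + 1), (-1:ℤ)^i * (t.choose i) * (q:ℤ)^(t-m-i)) * h3
  rw [Finset.sum_congr rfl h, h0, ← Finset.mul_sum, ← Finset.mul_sum]
  by_cases hmj : m ≤ j
  · rw [Fid q j (j-m) m (by omega)]; ring
  · rw [Finset.sum_eq_zero]
    · rw [show j - m = 0 by omega]; simp
    · intro t ht
      rw [Finset.mem_range] at ht
      rw [if_pos (by omega), mul_zero]

lemma expandA (n : ℕ) (a : ℕ → ℚ) :
    (∑ s ∈ Finset.range (n+1), MvPolynomial.C (a s) * X 0 ^ (n-s) * X 1 ^ s : MvPolynomial (Fin 2) ℚ)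
    = ∑ j ∈ Finset.range (n+1), MvPolynomial.C (∑ s ∈ Finset.range (j+1), a s * ((n-s).choose (n-j) : ℚ))
        * (X 0 - X 1)^(n-j) * X 1 ^ j := by
  have h : ∀ s ∈ Finset.range (n+1), (MvPolynomial.C (a s) * X 0 ^ (n-s) * X 1 ^ s : MvPolynomial (Fin 2) ℚ)
     = ∑ j ∈ Finset.range (n+1), MvPolynomial.C (a s * ((n-s).choose (n-j) : ℚ)) * (X 0 - X 1)^(n-j) * X 1 ^ j := by
    intro s hs
    rw [Finset.mem_range] at hs
    rw [← Finset.sum_range_reflect]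
    have e : (X 0 : MvPolynomial (Fin 2) ℚ) ^ (n-s) = ((X 0 - X 1) + X 1)^(n-s) := by ring
    rw [e, add_pow, show n + 1 = (n - s + 1) + s by omega, Finset.sum_range_add _ (n-s+1) s]
    rw [Finset.sum_eq_zero (s := Finset.range s), add_zero, Finset.mul_sum, Finset.sum_mul]
    · apply Finset.sum_congr rfl
      intro t ht
      rw [Finset.mem_range] at ht
      rw [show n - (n - s + 1 + s - 1 - t) = t by omega, show n - s + 1 + s - 1 - t = (n - s - t) + s by omega]
      simp only [map_mul, map_natCast, pow_add]; ring
    · intro t ht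
      rw [Finset.mem_range] at ht
      rw [Nat.choose_eq_zero_of_lt (by omega)]; simp
  rw [Finset.sum_congr rfl h, Finset.sum_comm]
  apply Finset.sum_congr rfl
  intro j hj
  rw [Finset.mem_range] at hj
  rw [map_sum, Finset.sum_mul, Finset.sum_mul]
  symm
  apply Finset.sum_subset
  · intro x; simp only [Finset.mem_range]; omega
  · intro s hs hs'
    simp only [Finset.mem_range] at hs hs'
    rw [Nat.choose_eq_zero_of_lt (by omega)]; simp

lemma indepB (n : ℕ) (e f : ℕ → ℚ)
    (h : (∑ j ∈ Finset.range (n+1), MvPolynomial.C (e j) * (X 0 - X 1)^(n-j) * X 1 ^ j : MvPolynomial (Fin 2) ℚ)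
     = ∑ j ∈ Finset.range (n+1), MvPolynomial.C (f j) * (X 0 - X 1)^(n-j) * X 1 ^ j) (j : ℕ) (hj : j ≤ n) : e j = f j := by
  have h2 := congrArg (fun p => (MvPolynomial.aeval (![1 + Polynomial.X, Polynomial.X] : Fin 2 → Polynomial ℚ) p).coeff j) h
  simp [MvPolynomial.algHom_C, Polynomial.coeff_X_pow] at h2
  simpa [Nat.lt_succ_iff, hj] using h2

lemma mdsEnum_eq (q n m : ℕ) : mdsEnum q n (m+1) = ∑ s ∈ Finset.range (n+1),
    MvPolynomial.C (mdsCoeff q n (m+1) s : ℚ) * X 0 ^ (n-s) * X 1 ^ s := by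
  unfold mdsEnum
  rw [Finset.range_eq_Ico, Finset.sum_eq_sum_Ico_succ_bot (by omega)]
  congr 1
  · simp [mdsCoeff]
  · have : Finset.Icc (m+1) n ⊆ Finset.Ico (0+1) (n+1) := by
      intro x; simp only [Finset.mem_Icc, Finset.mem_Ico]; omega
    rw [← Finset.sum_subset this]
    · apply Finset.sum_congr rfl
      intro s hs
      rw [Finset.mem_Icc] at hs
      unfold mdsCoeff
      rw [if_neg (by omega), if_neg (by omega)]
      push_cast; rfl
    · intro s hs hs'
      simp only [Finset.mem_Icc, Finset.mem_Ico] at hs hs'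
      unfold mdsCoeff
      rw [if_neg (by omega), if_pos (by omega)]
      simp

/-- restriction to `T` -/
def restr {G : Type*} [AddCommGroup G] {n : ℕ} (C : AddSubgroup (Fin n → G)) (T : Finset (Fin n)) :
    C →+ (T → G) where
  toFun c := fun i => (c : Fin n → G) i
  map_zero' := rfl
  map_add' _ _ := rfl

lemma card_vanish {G : Type*} [AddCommGroup G] [Fintype G] {n : ℕ}
    (C : AddSubgroup (Fin n → G)) (T : Finset (Fin n)) :
    Nat.card {c : Fin n → G // c ∈ C ∧ ∀ i ∈ T, c i = 0} * Nat.card (restr C T).range = Nat.card C := by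
  rw [← AddSubgroup.index_ker, ← AddSubgroup.card_mul_index (restr C T).ker]
  congr 1
  refine Nat.card_congr ⟨fun c => ⟨⟨c.1, c.2.1⟩, ?_⟩, fun c => ⟨c.1.1, c.1.2, ?_⟩, fun _ => rfl, fun _ => rfl⟩
  · rw [AddMonoidHom.mem_ker]
    ext i
    exact c.2.2 i i.2
  · intro i hi
    have := c.2
    rw [AddMonoidHom.mem_ker] at this
    exact congrFun this ⟨i, hi⟩

lemma range_le {G : Type*} [AddCommGroup G] [Fintype G] {n : ℕ}
    (C : AddSubgroup (Fin n → G)) (T : Finset (Fin n)) :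
    Nat.card (restr C T).range ≤ Fintype.card G ^ T.card := by
  have h := Nat.card_le_card_of_injective (Subtype.val : (restr C T).range → (T → G)) Subtype.val_injective
  simpa using h

lemma range_top {G : Type*} [AddCommGroup G] [Fintype G] {n d' : ℕ}
    (C : AddSubgroup (Fin n → G))
    (hmin' : d' ∈ lowerBounds {w | ∃ π ∈ dualCodeSet n (C : Set (Fin n → G)),
      π ≠ (fun _ => 1) ∧ charWeight π = w}) (T : Finset (Fin n)) (hT : T.card < d') :
    Nat.card (restr C T).range = Fintype.card G ^ T.card := by
  classical
  suffices h : (restr C T).range = ⊤ by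
    rw [h]; simp
  by_contra hne
  obtain ⟨v, hv⟩ : ∃ v, v ∉ (restr C T).range := by
    by_contra! hh
    exact hne ((AddSubgroup.eq_top_iff' _).2 hh)
  set H := (restr C T).range with hH
  have hv' : (QuotientAddGroup.mk v : (T → G) ⧸ H) ≠ 0 := by
    rwa [Ne, QuotientAddGroup.eq_zero_iff]
  obtain ⟨ψ, hψ⟩ := AddChar.exists_apply_ne_zero.2 hv'
  let χ : AddChar (T → G) ℂ := ψ.compAddMonoidHom (QuotientAddGroup.mk' H)
  have hχH : ∀ u ∈ H, χ u = 1 := by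
    intro u hu
    have : (QuotientAddGroup.mk u : (T → G) ⧸ H) = 0 := (QuotientAddGroup.eq_zero_iff u).2 hu
    change ψ (QuotientAddGroup.mk u) = 1
    rw [this]; simp
  let π : Fin n → AddChar G ℂ := fun j =>
    if hj : j ∈ T then χ.compAddMonoidHom (AddMonoidHom.single (fun _ : T => G) ⟨j, hj⟩) else 1
  have hprod : ∀ c : Fin n → G, ∏ j, π j (c j) = χ (fun i : T => c i) := by
    intro c
    have h1 : (fun i : T => c i) = ∑ i : T, Pi.single i (c i) := by
      exact (Finset.univ_sum_single (fun i : T => c i)).symm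
    have h2 : ∀ s : Finset T, χ (∑ i ∈ s, Pi.single i (c i)) = ∏ i ∈ s, χ (Pi.single i (c i)) := by
      intro s
      induction s using Finset.induction_on with
      | empty => simp
      | insert a s ha ih => rw [Finset.sum_insert ha, Finset.prod_insert ha, AddChar.map_add_eq_mul, ih]
    rw [h1, h2]
    rw [← Finset.prod_subset (Finset.subset_univ T), ← Finset.prod_coe_sort T]
    · apply Finset.prod_congr rfl
      intro i _
      simp [π]
    · intro j _ hj
      simp [π, hj]
  have hmem : charWeight π ∈ {w | ∃ π ∈ dualCodeSet n (C : Set (Fin n → G)),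
      π ≠ (fun _ => 1) ∧ charWeight π = w} := by
    refine ⟨π, ?_, ?_, rfl⟩
    · intro c hc
      rw [hprod]
      exact hχH _ ⟨⟨c, hc⟩, rfl⟩
    · intro h
      apply hψ
      have := hprod (fun j => if hj : j ∈ T then v ⟨j, hj⟩ else 0)
      rw [h] at this
      simp at this
      exact this.symm
  have hle : charWeight π ≤ T.card := by
    unfold charWeight
    rw [← (by simp : Nat.card (T : Set (Fin n)) = T.card)]
    apply Nat.card_le_card_of_injective
      (fun j : {j : Fin n // π j ≠ 1} => (⟨j.1, by
        by_contra hj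
        exact j.2 (by simp at hj; simp [π, hj])⟩ : (T : Set (Fin n))))
    intro a b hab
    simpa [Subtype.ext_iff] using hab
  have := hmin' hmem
  omega

lemma moment {G : Type*} [AddCommGroup G] [Fintype G] [DecidableEq G] {n : ℕ}
    (C : AddSubgroup (Fin n → G)) (j : ℕ) (hj : j ≤ n) :
    ∑ s ∈ Finset.range (j+1), Nat.card {c : Fin n → G // c ∈ C ∧ hammingNorm c = s} * (n-s).choose (n-j)
     = ∑ T ∈ Finset.powersetCard (n-j) (Finset.univ : Finset (Fin n)),
        Nat.card {c : Fin n → G // c ∈ C ∧ ∀ i ∈ T, c i = 0} := by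
  classical
  have hW : ∀ s, Nat.card {c : Fin n → G // c ∈ C ∧ hammingNorm c = s}
     = ∑ c : Fin n → G, if c ∈ C then (if hammingNorm c = s then 1 else 0) else 0 := by
    intro s
    rw [Nat.card_eq_fintype_card, Fintype.card_subtype, Finset.card_filter]
    apply Finset.sum_congr rfl
    intro c _
    split_ifs <;> simp_all
  have hT : ∀ T : Finset (Fin n), Nat.card {c : Fin n → G // c ∈ C ∧ ∀ i ∈ T, c i = 0}
     = ∑ c : Fin n → G, if c ∈ C then (if ∀ i ∈ T, c i = 0 then 1 else 0) else 0 := by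
    intro T
    rw [Nat.card_eq_fintype_card, Fintype.card_subtype, Finset.card_filter]
    apply Finset.sum_congr rfl
    intro c _
    by_cases h1 : c ∈ C <;> by_cases h2 : ∀ i ∈ T, c i = 0 <;> simp only [h1, h2] <;> simp
  simp only [hW, hT, Finset.sum_mul]
  rw [Finset.sum_comm, Finset.sum_comm (s := Finset.powersetCard _ _)]
  apply Finset.sum_congr rfl
  intro c _
  by_cases hc : c ∈ C
  · simp only [hc, if_true]
    have hz : (Finset.univ.filter (fun i => c i = 0)).card = n - hammingNorm c := by
      have := Finset.card_filter_add_card_filter_not (s := (Finset.univ : Finset (Fin n))) (fun i => c i = 0)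
      rw [Finset.card_univ, Fintype.card_fin] at this
      unfold hammingNorm
      simp only [ne_eq]
      omega
    have hr : ∑ T ∈ Finset.powersetCard (n-j) (Finset.univ : Finset (Fin n)),
        (if ∀ i ∈ T, c i = 0 then 1 else 0) = (n - hammingNorm c).choose (n-j) := by
      rw [← Finset.card_filter, ← hz, ← Finset.card_powersetCard]
      congr 1
      ext T
      simp [Finset.mem_powersetCard, Finset.subset_iff]
      tauto
    rw [hr]
    have hle : hammingNorm c ≤ n := by simpa using hammingNorm_le_card_fintype (x := c)
    simp only [ite_mul, one_mul, zero_mul, Finset.sum_ite_eq, Finset.mem_range]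
    split_ifs with h
    · rfl
    · rw [Nat.choose_eq_zero_of_lt (by omega)]
  · simp [hc]

lemma weightEnum_eq {G : Type*} [AddCommGroup G] [Fintype G] [DecidableEq G] {n : ℕ}
    (C : AddSubgroup (Fin n → G)) : weightEnum n (C : Set (Fin n → G)) = ∑ s ∈ Finset.range (n+1),
    MvPolynomial.C ((Nat.card {c : Fin n → G // c ∈ C ∧ hammingNorm c = s} : ℤ) : ℚ) * X 0 ^ (n-s) * X 1 ^ s := by
  classical
  unfold weightEnum
  rw [finsum_mem_eq_finite_toFinset_sum _ (Set.toFinite _)]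
  rw [← Finset.sum_fiberwise_of_maps_to (t := Finset.range (n+1)) (g := fun c => hammingNorm c)]
  · apply Finset.sum_congr rfl
    intro s _
    rw [Finset.sum_congr rfl (g := fun _ => X 0 ^ (n-s) * X 1 ^ s)]
    · rw [Finset.sum_const, Nat.card_eq_fintype_card, Fintype.card_subtype]
      simp only [nsmul_eq_mul, Int.cast_natCast, map_natCast, mul_assoc]
      congr 3
      ext c; simp
    · intro c hc
      rw [Finset.mem_filter] at hc
      rw [hc.2]
  · intro c _
    have hle : hammingNorm c ≤ n := by simpa using hammingNorm_le_card_fintype (x := c)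
    rw [Finset.mem_range]; omega

lemma excess_zero {G : Type*} [AddCommGroup G] [Fintype G]
    [DecidableEq G] [Nontrivial G]
    (n k d d' : ℕ) (hd : 2 ≤ d) (hd' : 2 ≤ d')
    (C : AddSubgroup (Fin n → G))
    (hk : Nat.card C = Fintype.card G ^ k)
    (hmin : IsLeast {w | ∃ c ∈ C, c ≠ 0 ∧ hammingNorm c = w} d)
    (hmin' : IsLeast {w | ∃ π ∈ dualCodeSet n (C : Set (Fin n → G)),
      π ≠ (fun _ => 1) ∧ charWeight π = w} d') :
    d ≤ n ∧ k ≤ n ∧ d + k ≤ n + 1 ∧ d' ≤ k + 1 ∧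
    ∀ j ≤ n, (j < d ∨ n < j + d') →
      ∑ s ∈ Finset.range (j + 1),
                ((Nat.card {c : Fin n → G // c ∈ C ∧ hammingNorm c = s} : ℤ)
                    - mdsCoeff (Fintype.card G) n (n + 1 - k) s) *
                  ((n - s).choose (n - j) : ℤ) = 0 := by
  have hq : 1 < Fintype.card G := Fintype.one_lt_card
  have hdn : d ≤ n := by
    obtain ⟨c, -, -, rfl⟩ := hmin.1
    simpa using hammingNorm_le_card_fintype (x := c)
  have hdn' : d' ≤ n := by
    obtain ⟨π, -, -, rfl⟩ := hmin'.1
    have := Nat.card_le_card_of_injective (Subtype.val : {j : Fin n // π j ≠ 1} → Fin n) Subtype.val_injective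
    simpa [charWeight] using this
  have hkn : k ≤ n := by
    have := Nat.card_le_card_of_injective (Subtype.val : C → (Fin n → G)) Subtype.val_injective
    rw [hk] at this
    simp at this
    exact (Nat.pow_le_pow_iff_right hq).1 this
  have hone : ∀ T : Finset (Fin n), n < T.card + d →
      Nat.card {c : Fin n → G // c ∈ C ∧ ∀ i ∈ T, c i = 0} = 1 := by
    intro T hT
    rw [Nat.card_eq_one_iff_unique]
    have key : ∀ c : Fin n → G, c ∈ C → (∀ i ∈ T, c i = 0) → c = 0 := by
      intro c hc hcT
      by_contra h0
      have h1 := hmin.2 ⟨c, hc, h0, rfl⟩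
      have h2 : hammingNorm c ≤ Tᶜ.card := by
        apply Finset.card_le_card
        intro i hi
        rw [Finset.mem_filter] at hi
        rw [Finset.mem_compl]
        exact fun h => hi.2 (hcT i h)
      have h3 := Finset.card_add_card_compl T
      rw [Fintype.card_fin] at h3
      omega
    refine ⟨⟨fun a b => ?_⟩, ⟨⟨0, C.zero_mem, fun _ _ => rfl⟩⟩⟩
    apply Subtype.ext
    rw [key a.1 a.2.1 a.2.2, key b.1 b.2.1 b.2.2]
  have hsing : d + k ≤ n + 1 := by
    obtain ⟨T, -, hT⟩ := Finset.exists_subset_card_eq (s := (Finset.univ : Finset (Fin n))) (n := n + 1 - d)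
      (by simp; omega)
    have h1 := card_vanish C T
    rw [hone T (by omega), one_mul, hk] at h1
    have h2 := range_le C T
    rw [h1, hT] at h2
    have := (Nat.pow_le_pow_iff_right hq).1 h2
    omega
  have hsing' : d' ≤ k + 1 := by
    obtain ⟨T, -, hT⟩ := Finset.exists_subset_card_eq (s := (Finset.univ : Finset (Fin n))) (n := d' - 1)
      (by simp; omega)
    have h1 := card_vanish C T
    rw [range_top C hmin'.2 T (by omega), hk, hT] at h1
    have h2 : Fintype.card G ^ (d' - 1) ∣ Fintype.card G ^ k := Dvd.intro_left _ h1
    have := (Nat.pow_dvd_pow_iff_le_right hq).1 h2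
    omega
  refine ⟨hdn, hkn, hsing, hsing', ?_⟩
  intro j hj hcase
  simp only [sub_mul, Finset.sum_sub_distrib]
  rw [show n + 1 - k = (n - k) + 1 by omega, mds_moment _ _ _ _ hj]
  have hm : ∑ s ∈ Finset.range (j+1), (Nat.card {c : Fin n → G // c ∈ C ∧ hammingNorm c = s} : ℤ) * ((n-s).choose (n-j) : ℤ)
    = ((∑ T ∈ Finset.powersetCard (n-j) (Finset.univ : Finset (Fin n)),
        Nat.card {c : Fin n → G // c ∈ C ∧ ∀ i ∈ T, c i = 0} : ℕ) : ℤ) := by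
    rw [← moment C j hj]; push_cast; rfl
  rw [hm, Finset.sum_congr rfl (g := fun _ => Fintype.card G ^ (j - (n-k)))]
  · rw [Finset.sum_const, Finset.card_powersetCard, Finset.card_univ, Fintype.card_fin, Nat.choose_symm hj]
    simp
  · intro T hT
    rw [Finset.mem_powersetCard] at hT
    rcases hcase with h | h
    · rw [hone T (by omega), show j - (n-k) = 0 by omega, pow_zero]
    · have h1 := card_vanish C T
      rw [range_top C hmin'.2 T (by omega), hk, hT.2] at h1
      have h2 : Fintype.card G ^ k = Fintype.card G ^ (j - (n-k)) * Fintype.card G ^ (n-j) := by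
        rw [← pow_add]; congr 1; omega
      rw [h2] at h1
      exact Nat.eq_of_mul_eq_mul_right (by positivity) h1

/-- For an additive code `C ≤ Gⁿ` with `|C| = |G|^k`, minimum distance
`d ≥ 2`, dual minimum distance `d⊥ ≥ 2`, and genera `g = n+1-d-k`, `g⊥ = k+1-d⊥`, there
is a unique Duursma reduced polynomial `D_C(t) = ∑_{i=0}^{g+g⊥-2} c_i t^i` with
`W_C(x,y) = M_{n,n+1-k}(x,y) + ∑_i C(n,d+i)(|G|-1) c_i (x-y)^(n-d-i) y^(d+i)`, and its
coefficients satisfy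
`(|G|-1)·C(n,d+i)·c_i = ∑_{s=0}^{d+i} (W_C^{(s)} - M_{n,n+1-k}^{(s)})·C(n-s,n-d-i) ∈ ℤ`. -/
theorem Duursma_reduced_polynomial {G : Type*} [AddCommGroup G] [Fintype G]
    [DecidableEq G] [Nontrivial G]
    (n k d d' g g' : ℕ) (hd : 2 ≤ d) (hd' : 2 ≤ d')
    (C : AddSubgroup (Fin n → G))
    (hk : Nat.card C = Fintype.card G ^ k)
    (hmin : IsLeast {w | ∃ c ∈ C, c ≠ 0 ∧ hammingNorm c = w} d)
    (hmin' : IsLeast {w | ∃ π ∈ dualCodeSet n (C : Set (Fin n → G)),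
      π ≠ (fun _ => 1) ∧ charWeight π = w} d')
    (hg : g = n + 1 - d - k) (hg' : g' = k + 1 - d') :
    (∃! D : Polynomial ℚ,
        (∀ j, g + g' - 1 ≤ j → D.coeff j = 0) ∧
        weightEnum n (C : Set (Fin n → G))
          = mdsEnum (Fintype.card G) n (n + 1 - k) +
              ∑ i ∈ Finset.range (g + g' - 1),
                MvPolynomial.C ((n.choose (d + i) : ℚ) * ((Fintype.card G : ℚ) - 1) *
                    D.coeff i) *
                  (X 0 - X 1) ^ (n - d - i) * X 1 ^ (d + i)) ∧
    (∀ D : Polynomial ℚ,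
        ((∀ j, g + g' - 1 ≤ j → D.coeff j = 0) ∧
          weightEnum n (C : Set (Fin n → G))
            = mdsEnum (Fintype.card G) n (n + 1 - k) +
                ∑ i ∈ Finset.range (g + g' - 1),
                  MvPolynomial.C ((n.choose (d + i) : ℚ) * ((Fintype.card G : ℚ) - 1) *
                      D.coeff i) *
                    (X 0 - X 1) ^ (n - d - i) * X 1 ^ (d + i)) →
        ∀ i, i ≤ g + g' - 2 →
          ((Fintype.card G : ℚ) - 1) * (n.choose (d + i) : ℚ) * D.coeff i
            = ((∑ s ∈ Finset.range (d + i + 1),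
                ((Nat.card {c : Fin n → G // c ∈ C ∧ hammingNorm c = s} : ℤ)
                    - mdsCoeff (Fintype.card G) n (n + 1 - k) s) *
                  ((n - s).choose (n - d - i) : ℤ) : ℤ) : ℚ)) := by
  classical
  obtain ⟨hdn, hkn, hs, hs', hz⟩ := excess_zero n k d d' hd hd' C hk hmin hmin'
  have hq : (1:ℚ) < Fintype.card G := by exact_mod_cast Fintype.one_lt_card
  have hq0 : (Fintype.card G : ℚ) - 1 ≠ 0 := by linarith
  set N := g + g' - 1 with hN
  have hdN : d + N ≤ n + 1 := by omega
  have hdN' : n < d + N + d' := by omega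
  let a : ℕ → ℤ := fun s => (Nat.card {c : Fin n → G // c ∈ C ∧ hammingNorm c = s} : ℤ)
                    - mdsCoeff (Fintype.card G) n (n + 1 - k) s
  let e : ℕ → ℤ := fun j => ∑ s ∈ Finset.range (j + 1), a s * ((n - s).choose (n - j) : ℤ)
  have he0 : ∀ j ≤ n, (j < d ∨ d + N ≤ j) → e j = 0 := by
    intro j hj h
    exact hz j hj (by omega)
  have hdiff : weightEnum n (C : Set (Fin n → G)) = mdsEnum (Fintype.card G) n (n + 1 - k) +
      ∑ j ∈ Finset.range (n+1), MvPolynomial.C (e j : ℚ) * (X 0 - X 1)^(n-j) * X 1 ^ j := by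
    have h1 : ∀ j, (e j : ℚ) = ∑ s ∈ Finset.range (j+1), (a s : ℚ) * ((n - s).choose (n - j) : ℚ) := by
      intro j; simp only [e]; push_cast; rfl
    simp only [h1]
    rw [← expandA, weightEnum_eq]
    rw [show n + 1 - k = (n - k) + 1 by omega, mdsEnum_eq, ← Finset.sum_add_distrib]
    apply Finset.sum_congr rfl
    intro s _
    rw [← add_mul, ← add_mul, ← map_add]
    simp only [a, show n + 1 - k = (n - k) + 1 by omega]
    congr 4
    push_cast; ring
  have hsum : ∀ D : Polynomial ℚ, (∑ i ∈ Finset.range N,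
                MvPolynomial.C ((n.choose (d + i) : ℚ) * ((Fintype.card G : ℚ) - 1) *
                    D.coeff i) *
                  (X 0 - X 1) ^ (n - d - i) * X 1 ^ (d + i) : MvPolynomial (Fin 2) ℚ) =
      ∑ j ∈ Finset.range (n+1), MvPolynomial.C (if d ≤ j ∧ j < d + N then
        (n.choose j : ℚ) * ((Fintype.card G : ℚ) - 1) * D.coeff (j - d) else 0) * (X 0 - X 1)^(n-j) * X 1 ^ j := by
    intro D
    have hsub : Finset.Ico d (d + N) ⊆ Finset.range (n+1) := by
      intro x; simp only [Finset.mem_Ico, Finset.mem_range]; omega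
    rw [← Finset.sum_subset hsub, Finset.sum_Ico_eq_sum_range, Nat.add_sub_cancel_left]
    · apply Finset.sum_congr rfl
      intro i hi
      rw [Finset.mem_range] at hi
      rw [if_pos (by omega), Nat.add_sub_cancel_left, Nat.sub_sub]
    · intro j _ hj
      rw [Finset.mem_Ico] at hj
      rw [if_neg hj]; simp
  have hiff : ∀ D : Polynomial ℚ, (weightEnum n (C : Set (Fin n → G))
          = mdsEnum (Fintype.card G) n (n + 1 - k) +
              ∑ i ∈ Finset.range N,
                MvPolynomial.C ((n.choose (d + i) : ℚ) * ((Fintype.card G : ℚ) - 1) *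
                    D.coeff i) *
                  (X 0 - X 1) ^ (n - d - i) * X 1 ^ (d + i)) ↔
      ∀ i < N, (e (d+i) : ℚ) = (n.choose (d + i) : ℚ) * ((Fintype.card G : ℚ) - 1) * D.coeff i := by
    intro D
    rw [hdiff, hsum, add_right_inj]
    constructor
    · intro h i hi
      have := indepB n _ _ h (d+i) (by omega)
      rw [this, if_pos (by omega), Nat.add_sub_cancel_left]
    · intro h
      apply Finset.sum_congr rfl
      intro j hj
      rw [Finset.mem_range] at hj
      congr 3
      split_ifs with hc
      · have := h (j - d) (by omega)
        rwa [show d + (j - d) = j by omega] at this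
      · rw [he0 j (by omega) (by omega)]; simp
  have hne : ∀ i < N, (n.choose (d + i) : ℚ) * ((Fintype.card G : ℚ) - 1) ≠ 0 := by
    intro i hi
    refine mul_ne_zero ?_ hq0
    exact_mod_cast (Nat.choose_pos (by omega)).ne'
  refine ⟨⟨∑ i ∈ Finset.range N, Polynomial.monomial i
      ((e (d+i) : ℚ) / ((n.choose (d + i) : ℚ) * ((Fintype.card G : ℚ) - 1))), ⟨?_, ?_⟩, ?_⟩, ?_⟩
  · intro j hj
    rw [Polynomial.finset_sum_coeff]
    apply Finset.sum_eq_zero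
    intro i hi
    rw [Finset.mem_range] at hi
    rw [Polynomial.coeff_monomial, if_neg (by omega)]
  · rw [hiff]
    intro i hi
    rw [Polynomial.finset_sum_coeff]
    simp only [Polynomial.coeff_monomial, Finset.sum_ite_eq', Finset.mem_range, hi, if_true]
    rw [mul_div_cancel₀ _ (hne i hi)]
  · rintro D ⟨h0, h1⟩
    rw [hiff] at h1
    ext j
    rw [Polynomial.finset_sum_coeff]
    simp only [Polynomial.coeff_monomial, Finset.sum_ite_eq', Finset.mem_range]
    split_ifs with hj
    · rw [h1 j hj, mul_div_cancel_left₀ _ (hne j hj)]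
    · exact h0 j (by omega)
  · rintro D ⟨h0, h1⟩ i hi
    rw [hiff] at h1
    have hee : (∑ s ∈ Finset.range (d + i + 1),
                ((Nat.card {c : Fin n → G // c ∈ C ∧ hammingNorm c = s} : ℤ)
                    - mdsCoeff (Fintype.card G) n (n + 1 - k) s) *
                  ((n - s).choose (n - d - i) : ℤ)) = e (d + i) := by
      rw [Nat.sub_sub]
    rw [hee]
    by_cases hiN : i < N
    · rw [h1 i hiN]; ring
    · rw [h0 i (by omega), he0 (d+i) (by omega) (by omega)]; simp
end
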